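/- arXiv:2001.06470 — 5 statements merged into one kernel-verified Lean document; each statement's English description precedes it below -/
import Mathlib

section
/- A matrix A ∈ 𝒢̃ is a companion matrix if and only if A ∈ 𝒢̂ and s_{k−1}(A) = x_k for every k = 1,…,n. -/
open Polynomial Matrix

noncomputable section

/-- A square matrix is *unit lower Hessenberg* (ULH): every entry on the
superdiagonal equals `1` and every entry above the superdiagonal equals `0`. -/
def IsULH {R : Type*} [Zero R] [One R] {m : ℕ} (A : Matrix (Fin m) (Fin m) R) : Prop :=
  (∀ i j : Fin m, (j : ℕ) = (i : ℕ) + 1 → A i j = 1) ∧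
  (∀ i j : Fin m, (i : ℕ) + 1 < (j : ℕ) → A i j = 0)

/-- The total order `≺` on positions: `(i,j) ≺ (i',j')` iff `i−j < i'−j'`, or
`i−j = i'−j'` and `i < i'`. -/
def Prec {m : ℕ} (a b : Fin m × Fin m) : Prop :=
  ((a.1 : ℕ) - (a.2 : ℕ) < (b.1 : ℕ) - (b.2 : ℕ)) ∨
  ((a.1 : ℕ) - (a.2 : ℕ) = (b.1 : ℕ) - (b.2 : ℕ) ∧ (a.1 : ℕ) < (b.1 : ℕ))

/-- `pos` is a valid family of variable positions for a matrix of `ℋ`: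
each position is on or below the main diagonal, and the positions are
strictly increasing in the order `≺`. -/
def IsHPos {m : ℕ} (pos : Fin m → Fin m × Fin m) : Prop :=
  (∀ k, ((pos k).2 : ℕ) ≤ ((pos k).1 : ℕ)) ∧
  (∀ k l : Fin m, k < l → Prec (pos k) (pos l))

/-- `pos` is a valid family of variable positions for a matrix of `ℬ`:
in addition all variables lie in a common `t`-block, i.e.
`max j_k ≤ min i_k`. -/
def IsBPos {m : ℕ} (pos : Fin m → Fin m × Fin m) : Prop :=
  IsHPos pos ∧ ∀ k l : Fin m, ((pos k).2 : ℕ) ≤ ((pos l).1 : ℕ)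

/-- The ULH matrix `H_{(i₁,j₁),…,(iₙ,jₙ)}` with `2n−1` nonzero entries: ones on the
superdiagonal and the variable `xₖ` at position `pos k` (0-indexed). -/
def HMat (F : Type*) [Field F] {n : ℕ} (pos : Fin n → Fin n × Fin n) :
    Matrix (Fin n) (Fin n) (MvPolynomial (Fin n) F) :=
  fun i j => (if (j : ℕ) = (i : ℕ) + 1 then 1 else 0) +
    ∑ k : Fin n, if pos k = (i, j) then MvPolynomial.X k else 0

/-- The positions of the variables of `C_{i₁,…,iₙ}`: in 1-based terms `xₖ` lies at
`(iₖ, iₖ−k+1)`; here 0-indexed, given the row function `r`, the variable `x_{k+1}`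
lies at `(r k, r k − k)`. -/
def CPos {n : ℕ} (r : Fin n → Fin n) (k : Fin n) : Fin n × Fin n :=
  (r k, ⟨(r k : ℕ) - (k : ℕ), lt_of_le_of_lt (Nat.sub_le _ _) (r k).isLt⟩)

/-- The condition on the row indices defining the set `𝒞`: in 1-based terms
`k ≤ iₖ` and `iₖ−k+1 ≤ i₁ ≤ iₖ` for `k = 1,…,n`. -/
def IsCIdx {n : ℕ} (hn : 0 < n) (r : Fin n → Fin n) : Prop :=
  ∀ k : Fin n, (k : ℕ) ≤ (r k : ℕ) ∧
    (r k : ℕ) - (k : ℕ) ≤ (r ⟨0, hn⟩ : ℕ) ∧ (r ⟨0, hn⟩ : ℕ) ≤ (r k : ℕ)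

/-- The matrix `C_{i₁,…,iₙ}`. -/
def CMat (F : Type*) [Field F] {n : ℕ} (r : Fin n → Fin n) :
    Matrix (Fin n) (Fin n) (MvPolynomial (Fin n) F) :=
  HMat F (CPos r)

/-- The condition on the row indices defining the set `𝒢`: besides the `𝒞` conditions,
the rows of the variables are exactly `i₁,…,n` and their columns exactly `1,…,i₁`. -/
def IsGIdx {n : ℕ} (hn : 0 < n) (r : Fin n → Fin n) : Prop :=
  IsCIdx hn r ∧
  (∀ i : Fin n, (∃ k, r k = i) ↔ (r ⟨0, hn⟩ : ℕ) ≤ (i : ℕ)) ∧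
  (∀ j : Fin n, (∃ k, (r k : ℕ) - (k : ℕ) = (j : ℕ)) ↔ (j : ℕ) ≤ (r ⟨0, hn⟩ : ℕ))

/-- The condition on the row indices defining the set `ℱ` of Fiedler companion
matrices: besides the `𝒢` conditions, consecutive variables lie in the same row or
the same column, i.e. `i_{k+1} = i_k` or `i_{k+1} = i_k + 1`. -/
def IsFIdx {n : ℕ} (hn : 0 < n) (r : Fin n → Fin n) : Prop :=
  IsGIdx hn r ∧
  ∀ k l : Fin n, (l : ℕ) = (k : ℕ) + 1 → (r l = r k ∨ (r l : ℕ) = (r k : ℕ) + 1)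

/-- `B` is a *ULH superpattern* of `A`: `B` is obtained from `A` by replacing some
(possibly none) zero entries of `A` lying below the superdiagonal by nonzero
constants of `F`. -/
def IsULHSuperpatternOf {F : Type*} [Field F] {n : ℕ}
    (B A : Matrix (Fin n) (Fin n) (MvPolynomial (Fin n) F)) : Prop :=
  (∀ i j : Fin n, (i : ℕ) < (j : ℕ) → B i j = A i j) ∧
  (∀ i j : Fin n, (j : ℕ) ≤ (i : ℕ) →
    B i j = A i j ∨ (A i j = 0 ∧ ∃ c : F, c ≠ 0 ∧ B i j = MvPolynomial.C c))

/-- `A` is a *companion matrix*: `n` of its entries are the variables `x₁,…,xₙ`,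
the remaining entries are constants of `F`, and
`det(λI − A) = λⁿ − x₁λ^{n−1} − ⋯ − xₙ`. -/
def IsCompanion {F : Type*} [Field F] {n : ℕ}
    (A : Matrix (Fin n) (Fin n) (MvPolynomial (Fin n) F)) : Prop :=
  (∃ pos : Fin n → Fin n × Fin n, Function.Injective pos ∧
    (∀ k : Fin n, A (pos k).1 (pos k).2 = MvPolynomial.X k) ∧
    (∀ i j : Fin n, (∀ k, pos k ≠ (i, j)) → ∃ c : F, A i j = MvPolynomial.C c)) ∧
  A.charpoly = Polynomial.X ^ n -
    ∑ k : Fin n, Polynomial.C (MvPolynomial.X k) * Polynomial.X ^ (n - 1 - (k : ℕ))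

/-- `A` is a *PB-companion matrix* (companion with respect to a polynomial basis):
`n` of its entries are the variables `x₁,…,xₙ`, the remaining entries are constants
of `F`, and `det(λI − A) = pₙ(λ) − x₁p_{n−1}(λ) − ⋯ − xₙp₀(λ)` for some basis
`{pₙ,…,p₀}` of the space `F_n[λ]` of polynomials of degree at most `n`. -/
def IsPBCompanion {F : Type*} [Field F] {n : ℕ}
    (A : Matrix (Fin n) (Fin n) (MvPolynomial (Fin n) F)) : Prop :=
  (∃ pos : Fin n → Fin n × Fin n, Function.Injective pos ∧
    (∀ k : Fin n, A (pos k).1 (pos k).2 = MvPolynomial.X k) ∧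
    (∀ i j : Fin n, (∀ k, pos k ≠ (i, j)) → ∃ c : F, A i j = MvPolynomial.C c)) ∧
  ∃ p : Fin (n + 1) → Polynomial F,
    (∀ i, p i ∈ Polynomial.degreeLT F (n + 1)) ∧
    LinearIndependent F p ∧
    Submodule.span F (Set.range p) = Polynomial.degreeLT F (n + 1) ∧
    A.charpoly = (p ⟨n, n.lt_succ_self⟩).map (MvPolynomial.C : F →+* MvPolynomial (Fin n) F) -
      ∑ k : Fin n, Polynomial.C (MvPolynomial.X k) *
        (p ⟨n - 1 - (k : ℕ), by omega⟩).map (MvPolynomial.C : F →+* MvPolynomial (Fin n) F)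

/-- The constant part of `A`: set `x₁ = ⋯ = xₙ = 0` in every entry. -/
def constPart {F : Type*} [Field F] {n : ℕ}
    (A : Matrix (Fin n) (Fin n) (MvPolynomial (Fin n) F)) : Matrix (Fin n) (Fin n) F :=
  A.map (fun q => MvPolynomial.eval (fun _ => (0 : F)) q)

/-- The leading principal submatrix `A[1,…,m]` of order `m`. -/
def leadSub {R : Type*} {n : ℕ} (A : Matrix (Fin n) (Fin n) R) (m : ℕ) (h : m ≤ n) :
    Matrix (Fin m) (Fin m) R :=
  A.submatrix (Fin.castLE h) (Fin.castLE h)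

/-- The trailing principal submatrix `A[n−m+1,…,n]` of order `m`. -/
def trailSub {R : Type*} {n : ℕ} (A : Matrix (Fin n) (Fin n) R) (m : ℕ) (h : m ≤ n) :
    Matrix (Fin m) (Fin m) R :=
  A.submatrix (fun i => ⟨n - m + (i : ℕ), by omega⟩) (fun i => ⟨n - m + (i : ℕ), by omega⟩)

/-- A matrix whose entries are all constants of `F`. -/
def IsConstMatrix {F : Type*} [Field F] {n m : ℕ}
    (M : Matrix (Fin m) (Fin m) (MvPolynomial (Fin n) F)) : Prop :=
  ∀ i j, ∃ c : F, M i j = MvPolynomial.C c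

/-- Membership in `𝔑^m_L(n₁,…,n_s)`: a constant ULH matrix of order `m` whose
leading principal submatrix of order `ns h` is nilpotent whenever `ns h ≠ 0`. -/
def MemNL {F : Type*} [Field F] {m : ℕ} (M : Matrix (Fin m) (Fin m) F)
    {s : ℕ} (ns : Fin s → ℕ) (hns : ∀ h, ns h ≤ m) : Prop :=
  IsULH M ∧ ∀ h : Fin s, ns h ≠ 0 → IsNilpotent (leadSub M (ns h) (hns h))

/-- Membership in `𝔑^m_T(n₁,…,n_s)`: a constant ULH matrix of order `m` whose
trailing principal submatrix of order `ns h` is nilpotent whenever `ns h ≠ 0`. -/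
def MemNT {F : Type*} [Field F] {m : ℕ} (M : Matrix (Fin m) (Fin m) F)
    {s : ℕ} (ns : Fin s → ℕ) (hns : ∀ h, ns h ≤ m) : Prop :=
  IsULH M ∧ ∀ h : Fin s, ns h ≠ 0 → IsNilpotent (trailSub M (ns h) (hns h))

/-- `s_k(A)`: the sum of the entries of the `k`-subdiagonal of `A`. -/
def subdiagSum {F : Type*} [Field F] {n : ℕ}
    (A : Matrix (Fin n) (Fin n) (MvPolynomial (Fin n) F)) (k : ℕ) : MvPolynomial (Fin n) F :=
  ∑ i : Fin n, ∑ j : Fin n, if (i : ℕ) = (j : ℕ) + k then A i j else 0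

/-- The upper shift matrix `Uₘ`: ones on the superdiagonal, zeros elsewhere. -/
def Ushift (R : Type*) [Zero R] [One R] (m : ℕ) : Matrix (Fin m) (Fin m) R :=
  fun i j => if (j : ℕ) = (i : ℕ) + 1 then 1 else 0

/-- The backward identity matrix `Jₘ`: ones on the antidiagonal, zeros elsewhere. -/
def Jmat (R : Type*) [Zero R] [One R] (m : ℕ) : Matrix (Fin m) (Fin m) R :=
  fun i j => if (i : ℕ) + (j : ℕ) = m - 1 then 1 else 0

/-- The principal submatrix `M[b,…,e]` on rows and columns `b,…,e` (0-indexed). -/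
def rangeSub {R : Type*} {m : ℕ} (M : Matrix (Fin m) (Fin m) R) (b e : ℕ) (h : e < m) :
    Matrix (Fin (e + 1 - b)) (Fin (e + 1 - b)) R :=
  M.submatrix (fun i => ⟨b + (i : ℕ), by omega⟩) (fun i => ⟨b + (i : ℕ), by omega⟩)

section HessenbergSequence

variable {R : Type*} [CommRing R] {n : ℕ}

/-- The polynomials `p₀ = 1`, `pᵢ₊₁ = X pᵢ − ∑_{j ≤ i} aᵢⱼ pⱼ`: for a unit lower Hessenberg
matrix, `pᵢ` is the characteristic polynomial of the leading principal submatrix of order `i`. -/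
def hessSeq (A : Matrix (Fin n) (Fin n) R) : ℕ → R[X]
  | 0 => 1
  | i + 1 => if h : i < n then
      X * hessSeq A i -
        ∑ j : Fin n, if (j : ℕ) < i + 1 then Polynomial.C (A ⟨i, h⟩ j) * hessSeq A j else 0
    else 0

lemma hessSeq_zero (A : Matrix (Fin n) (Fin n) R) : hessSeq A 0 = 1 := by
  rw [hessSeq]

lemma hessSeq_succ (A : Matrix (Fin n) (Fin n) R) (i : Fin n) :
    hessSeq A (i + 1) = X * hessSeq A i -
      ∑ j : Fin n, if (j : ℕ) < i + 1 then Polynomial.C (A i j) * hessSeq A j else 0 := by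
  rw [hessSeq, dif_pos i.isLt]

lemma hessSeq_congr {A B : Matrix (Fin n) (Fin n) R} {t : ℕ} (ht : t ≤ n)
    (h : ∀ i j : Fin n, (i : ℕ) < t → A i j = B i j) :
    ∀ i ≤ t, hessSeq A i = hessSeq B i := by
  intro i
  induction i using Nat.strong_induction_on with
  | _ i ih =>
    intro hi
    cases i with
    | zero => rw [hessSeq_zero, hessSeq_zero]
    | succ i =>
      have hA := hessSeq_succ A ⟨i, by omega⟩
      have hB := hessSeq_succ B ⟨i, by omega⟩
      simp only at hA hB
      rw [hA, hB, ih i (by omega) (by omega)]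
      congr 1
      refine Finset.sum_congr rfl fun j _ => ?_
      split_ifs with hj
      · rw [ih j hj (by omega), h _ _ (by simp; omega)]
      · rfl

lemma hessSeq_isMonicOfDegree [Nontrivial R] (A : Matrix (Fin n) (Fin n) R) :
    ∀ i ≤ n, IsMonicOfDegree (hessSeq A i) i := by
  intro i
  induction i using Nat.strong_induction_on with
  | _ i ih =>
    intro hi
    cases i with
    | zero => rw [hessSeq_zero]; exact isMonicOfDegree_zero_iff.2 rfl
    | succ i =>
      have hA := hessSeq_succ A ⟨i, by omega⟩
      simp only at hA
      rw [hA, sub_eq_add_neg, mul_comm]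
      refine IsMonicOfDegree.add_right
        ((ih i (by omega) (by omega)).mul (isMonicOfDegree_X R)) ?_
      rw [natDegree_neg]
      refine Nat.lt_succ_of_le (natDegree_sum_le_of_forall_le _ _ fun j _ => ?_)
      split_ifs with hj
      · exact (natDegree_C_mul_le _ _).trans ((ih j hj (by omega)).natDegree_eq.trans_le (by omega))
      · simp

lemma hessSeq_eq_X_pow {A : Matrix (Fin n) (Fin n) R} {t : ℕ} (ht : t ≤ n)
    (h : ∀ i j : Fin n, (i : ℕ) < t → j ≤ i → A i j = 0) :
    ∀ i ≤ t, hessSeq A i = X ^ i := by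
  intro i
  induction i with
  | zero => intro; rw [hessSeq_zero, pow_zero]
  | succ i ih =>
    intro hi
    have hA := hessSeq_succ A ⟨i, by omega⟩
    simp only at hA
    rw [hA, ih (by omega), Finset.sum_eq_zero, sub_zero, pow_succ']
    intro j _
    split_ifs with hj
    · rw [h _ _ (by simp; omega) (by simp [Fin.le_def]; omega)]; simp
    · rfl

lemma eq_zero_of_hessSeq_eq_X_pow {A : Matrix (Fin n) (Fin n) R} {t : ℕ}
    (h : ∀ i ≤ t, hessSeq A i = X ^ i) (i j : Fin n) (hi : (i : ℕ) < t) (hji : j ≤ i) :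
    A i j = 0 := by
  have hs := hessSeq_succ A i
  rw [h _ hi, h _ hi.le, ← pow_succ', eq_comm, sub_eq_self] at hs
  have hc := congrArg (fun p => coeff p (j : ℕ)) hs
  simp only [finsetSum_coeff, coeff_zero] at hc
  rw [Finset.sum_eq_single j] at hc
  · rw [if_pos (Nat.lt_succ_of_le hji), h _ (by rw [Fin.le_def] at hji; omega)] at hc
    simpa using hc
  · intro b _ hb
    split_ifs with hbi
    · rw [h _ (by omega), coeff_C_mul, coeff_X_pow, if_neg, mul_zero]
      exact fun e => hb (Fin.ext e.symm)
    · simp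
  · simp

lemma charmatrix_mulVec_hessSeq {A : Matrix (Fin n) (Fin n) R} (hA : IsULH A) (i : Fin n) :
    (charmatrix A *ᵥ fun j => hessSeq A j) i =
      if (i : ℕ) + 1 = n then hessSeq A n else 0 := by
  have hterm : ∀ j : Fin n, charmatrix A i j * hessSeq A j =
      ((if i = j then X * hessSeq A i else 0) -
        (if (j : ℕ) < i + 1 then Polynomial.C (A i j) * hessSeq A j else 0)) -
        (if (j : ℕ) = i + 1 then hessSeq A (i + 1) else 0) := by
    intro j
    rw [charmatrix_apply, Matrix.diagonal_apply]
    rcases lt_trichotomy (j : ℕ) (i + 1) with h | h | h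
    · rw [if_pos h, if_neg h.ne]
      split_ifs with hij
      · subst hij; ring
      · ring
    · have hij : i ≠ j := by rintro rfl; omega
      rw [if_neg hij, if_neg hij, if_neg (by omega), if_pos h, hA.1 i j h, h]
      simp
    · have hij : i ≠ j := by rintro rfl; omega
      rw [if_neg hij, if_neg hij, if_neg (by omega), if_neg (by omega), hA.2 i j h]
      simp
  simp only [Matrix.mulVec, dotProduct]
  rw [Finset.sum_congr rfl fun j _ => hterm j, Finset.sum_sub_distrib, Finset.sum_sub_distrib,
    Finset.sum_ite_eq, if_pos (Finset.mem_univ _), ← hessSeq_succ]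
  split_ifs with hi
  · rw [Finset.sum_eq_zero, sub_zero, hi]
    intro j _
    rw [if_neg (by omega)]
  · rw [Finset.sum_eq_single (⟨i + 1, by omega⟩ : Fin n)]
    · simp
    · intro b _ hb
      rw [if_neg]
      exact fun e => hb (Fin.ext e)
    · simp

lemma det_eq_mulVec_last {S : Type*} [CommRing S] {m : ℕ}
    {M : Matrix (Fin (m + 1)) (Fin (m + 1)) S}
    (hsuper : ∀ i j : Fin (m + 1), (j : ℕ) = i + 1 → M i j = -1)
    (habove : ∀ i j : Fin (m + 1), (i : ℕ) + 1 < j → M i j = 0)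
    (v : Fin (m + 1) → S) (hv : v 0 = 1) (hMv : ∀ i, i ≠ Fin.last m → (M *ᵥ v) i = 0) :
    M.det = (M *ᵥ v) (Fin.last m) := by
  have hadj : M.adjugate 0 (Fin.last m) = 1 := by
    rw [adjugate_fin_succ_eq_det_submatrix, Matrix.det_of_isLowerTriangular]
    · simp only [submatrix_apply, Fin.succAbove_last, Fin.succAbove_zero]
      rw [Finset.prod_congr rfl fun i _ => hsuper i.castSucc i.succ (by simp)]
      simp [← mul_pow]
    · intro i j hij
      have hij' : (i : ℕ) < j := hij
      simp only [submatrix_apply, Fin.succAbove_last, Fin.succAbove_zero]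
      exact habove _ _ (by simpa using hij')
  have h := congrFun (congrArg (fun N => N *ᵥ v) (adjugate_mul M)) 0
  simp only [← Matrix.mulVec_mulVec, Matrix.smul_mulVec, Matrix.one_mulVec, Pi.smul_apply, hv,
    smul_eq_mul, mul_one] at h
  rw [← h, Matrix.mulVec, dotProduct, Finset.sum_eq_single (Fin.last m), hadj, one_mul]
  · intro i _ hi
    rw [hMv i hi, mul_zero]
  · simp

lemma charmatrix_superdiagonal {A : Matrix (Fin n) (Fin n) R} (hA : IsULH A) {i j : Fin n}
    (h : (j : ℕ) = i + 1) : charmatrix A i j = -1 := by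
  rw [charmatrix_apply_ne _ _ _ (by rintro rfl; omega), hA.1 i j h, Polynomial.C_1]

lemma charmatrix_above {A : Matrix (Fin n) (Fin n) R} (hA : IsULH A) {i j : Fin n}
    (h : (i : ℕ) + 1 < j) : charmatrix A i j = 0 := by
  rw [charmatrix_apply_ne _ _ _ (by rintro rfl; omega), hA.2 i j h, Polynomial.C_0, neg_zero]

lemma charpoly_eq_hessSeq {A : Matrix (Fin n) (Fin n) R} (hA : IsULH A) :
    A.charpoly = hessSeq A n := by
  cases n with
  | zero => rw [hessSeq_zero, Matrix.charpoly, Matrix.det_isEmpty]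
  | succ m =>
    have h := det_eq_mulVec_last (M := charmatrix A) (fun _ _ => charmatrix_superdiagonal hA)
      (fun _ _ => charmatrix_above hA) (fun j => hessSeq A j) (hessSeq_zero A) ?_
    · rw [Matrix.charpoly, h, charmatrix_mulVec_hessSeq hA, if_pos (by simp)]
    · intro i hi
      rw [charmatrix_mulVec_hessSeq hA, if_neg]
      exact fun e => hi (Fin.ext (by simpa using e))

/-- The reflection of a matrix in its antidiagonal. -/
def antiTranspose (A : Matrix (Fin n) (Fin n) R) : Matrix (Fin n) (Fin n) R :=
  fun i j => A j.rev i.rev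

lemma IsULH.antiTranspose {A : Matrix (Fin n) (Fin n) R} (hA : IsULH A) :
    IsULH (antiTranspose A) :=
  ⟨fun i j h => hA.1 _ _ (by simp only [Fin.val_rev]; omega),
    fun i j h => hA.2 _ _ (by simp only [Fin.val_rev]; omega)⟩

lemma sum_hessSeq_antiTranspose_mul_charmatrix {A : Matrix (Fin n) (Fin n) R} (hA : IsULH A)
    {j : Fin n} (hj : (j : ℕ) ≠ 0) :
    ∑ i : Fin n, hessSeq (antiTranspose A) i.rev * charmatrix A i j = 0 := by
  have h := charmatrix_mulVec_hessSeq hA.antiTranspose j.rev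
  rw [if_neg (by simp only [Fin.val_rev]; omega)] at h
  rw [← h, Matrix.mulVec, dotProduct, ← Equiv.sum_comp Fin.revPerm]
  refine Finset.sum_congr rfl fun i _ => ?_
  simp only [Fin.revPerm_apply, charmatrix_apply, Matrix.diagonal_apply, _root_.antiTranspose,
    Fin.rev_rev]
  by_cases hij : j = i.rev
  · subst hij
    simp [mul_comm]
  · rw [if_neg, if_neg, mul_comm]
    · exact fun e => hij (by rw [← e, Fin.rev_rev])
    · exact fun e => hij e.symm

/-- Expansion of the characteristic polynomial of a unit lower Hessenberg matrix along its
block of rows `t, t + 1, …` and columns `0, …, t`. -/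
theorem charpoly_eq_sum_block {A : Matrix (Fin n) (Fin n) R} (hA : IsULH A) (t : Fin n) :
    A.charpoly = ∑ i : Fin n, ∑ j : Fin n, if t ≤ i ∧ j ≤ t then
      hessSeq (antiTranspose A) i.rev * charmatrix A i j * hessSeq A j else 0 := by
  have ht := t.isLt
  have hlast : ∑ i : Fin n, (if t ≤ i then hessSeq (antiTranspose A) i.rev *
      (charmatrix A *ᵥ fun j => hessSeq A j) i else 0) = A.charpoly := by
    rw [charpoly_eq_hessSeq hA, Finset.sum_eq_single (⟨n - 1, by omega⟩ : Fin n)]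
    · rw [if_pos (by rw [Fin.le_def]; simp; omega), charmatrix_mulVec_hessSeq hA,
        if_pos (by simp; omega), Fin.val_rev]
      simp only
      rw [show n - (n - 1 + 1) = 0 by omega, hessSeq_zero, one_mul]
    · intro i _ hi
      have hi' : ¬ (i : ℕ) + 1 = n := fun e => hi (Fin.ext (by simp only; omega))
      rw [charmatrix_mulVec_hessSeq hA, if_neg hi', mul_zero, ite_self]
    · simp
  have hcol : ∀ j : Fin n, t < j → ∑ i : Fin n,
      (if t ≤ i then hessSeq (antiTranspose A) i.rev * charmatrix A i j * hessSeq A j else 0)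
        = 0 := by
    intro j hj
    have hsum := congrArg (· * hessSeq A j) (sum_hessSeq_antiTranspose_mul_charmatrix hA
      (j := j) (by rw [Fin.lt_def] at hj; omega))
    simp only [zero_mul, Finset.sum_mul] at hsum
    refine (Finset.sum_congr rfl fun i _ => ?_).trans hsum
    split_ifs with hi
    · rfl
    · rw [Fin.lt_def] at hj
      rw [Fin.le_def] at hi
      rw [charmatrix_above hA (by omega), mul_zero, zero_mul]
  rw [← hlast]
  have hrow : ∀ i : Fin n, (if t ≤ i then hessSeq (antiTranspose A) i.rev *
      (charmatrix A *ᵥ fun j => hessSeq A j) i else 0) = ∑ j : Fin n, if t ≤ i then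
        hessSeq (antiTranspose A) i.rev * charmatrix A i j * hessSeq A j else 0 := by
    intro i
    split_ifs
    · simp only [Matrix.mulVec, dotProduct, Finset.mul_sum, mul_assoc]
    · simp
  rw [Finset.sum_congr rfl fun i _ => hrow i, Finset.sum_comm]
  conv_rhs => rw [Finset.sum_comm]
  refine Finset.sum_congr rfl fun j _ => ?_
  by_cases hj : j ≤ t
  · simp only [hj, and_true]
  · rw [hcol j (not_le.1 hj)]
    simp only [hj, and_false, if_false, Finset.sum_const_zero]

theorem charpoly_eq_of_block_support {A : Matrix (Fin n) (Fin n) R} (hA : IsULH A) (t : Fin n)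
    (hblock : ∀ i j : Fin n, A i j ≠ 0 → ((j : ℕ) = i + 1 ∨ (t ≤ i ∧ j ≤ t))) :
    A.charpoly = X ^ n - ∑ k : Fin n, Polynomial.C (∑ i : Fin n, ∑ j : Fin n,
      if (i : ℕ) = (j : ℕ) + k then A i j else 0) * X ^ (n - 1 - (k : ℕ)) := by
  have ht := t.isLt
  have hv : ∀ j : Fin n, j ≤ t → hessSeq A j = X ^ (j : ℕ) := by
    refine fun j hj => hessSeq_eq_X_pow ht.le (fun i j hi hji => ?_) j hj
    by_contra hne
    have := hblock i j hne
    simp only [Fin.le_def] at this hji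
    omega
  have hw : ∀ i : Fin n, t ≤ i → hessSeq (antiTranspose A) i.rev = X ^ (i.rev : ℕ) := by
    refine fun i hi => hessSeq_eq_X_pow (t := t.rev) t.rev.isLt.le (fun i j hi hji => ?_) i.rev
      (Fin.rev_le_rev.2 hi)
    by_contra hne
    have := hblock _ _ hne
    simp only [Fin.le_def, Fin.val_rev] at this hji hi
    omega
  have hterm : ∀ i j : Fin n, (if t ≤ i ∧ j ≤ t then
      hessSeq (antiTranspose A) i.rev * charmatrix A i j * hessSeq A j else 0) =
      (if i = t then if j = t then X ^ n else 0 else 0) -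
        (if j ≤ i then Polynomial.C (A i j) * X ^ (n - 1 - ((i : ℕ) - j)) else 0) := by
    intro i j
    by_cases hij : t ≤ i ∧ j ≤ t
    · rw [if_pos hij, hv j hij.2, hw i hij.1, if_pos (hij.2.trans hij.1), charmatrix_apply,
        Matrix.diagonal_apply, Fin.val_rev]
      have hexp : (X : R[X]) ^ (n - 1 - ((i : ℕ) - j)) = X ^ (n - (i + 1)) * X ^ (j : ℕ) := by
        rw [← pow_add]
        congr 1
        have := hij.2.trans hij.1
        rw [Fin.le_def] at this
        omega
      rw [hexp]
      by_cases h : i = j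
      · obtain rfl : i = t := le_antisymm (h ▸ hij.2) hij.1
        subst h
        rw [if_pos rfl, if_pos rfl, if_pos rfl]
        have hn : (X : R[X]) ^ n = X ^ (n - (i + 1)) * X ^ (i : ℕ) * X := by
          rw [← pow_add, ← pow_succ]
          congr 1
          omega
        rw [hn]
        ring
      · have h' : (if i = t then if j = t then (X : R[X]) ^ n else 0 else 0) = 0 := by
          split_ifs with h1 h2
          · exact absurd (h1.trans h2.symm) h
          · rfl
          · rfl
        rw [if_neg h, h']
        ring
    · have h' : (if i = t then if j = t then (X : R[X]) ^ n else 0 else 0) = 0 := by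
        split_ifs with h1 h2
        · exact absurd ⟨h1.ge, h2.le⟩ hij
        · rfl
        · rfl
      rw [if_neg hij, h', zero_sub, eq_comm, neg_eq_zero]
      split_ifs with hji
      · have hz : A i j = 0 := by
          by_contra hne
          have := (hblock i j hne).resolve_right hij
          rw [Fin.le_def] at hji
          omega
        rw [hz, Polynomial.C_0, zero_mul]
      · rfl
  rw [charpoly_eq_sum_block hA t]
  simp only [hterm, Finset.sum_sub_distrib]
  congr 1
  · rw [Finset.sum_eq_single t (fun i _ hi => by simp [hi]) (by simp)]
    simp
  · simp only [map_sum, Finset.sum_mul]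
    rw [Finset.sum_comm (γ := Fin n)]
    conv_rhs => rw [Finset.sum_comm]; enter [2, i]; rw [Finset.sum_comm]
    rw [Finset.sum_comm]
    refine Finset.sum_congr rfl fun i _ => Finset.sum_congr rfl fun j _ => ?_
    split_ifs with hji
    · rw [Fin.le_def] at hji
      rw [Finset.sum_eq_single (⟨(i : ℕ) - j, by omega⟩ : Fin n)]
      · rw [if_pos (by simp only; omega)]
      · intro k _ hk
        rw [if_neg, Polynomial.C_0, zero_mul]
        exact fun e => hk (Fin.ext (by simp only; omega))
      · simp
    · rw [Finset.sum_eq_zero]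
      intro k _
      rw [Fin.le_def] at hji
      rw [if_neg (by omega), Polynomial.C_0, zero_mul]

/-- Perturbing one entry of the block of rows `t, t + 1, …` and columns `0, …, t`. -/
theorem charpoly_add_single {A : Matrix (Fin n) (Fin n) R} (hA : IsULH A) {t i₀ j₀ : Fin n}
    (hi₀ : t ≤ i₀) (hj₀ : j₀ ≤ t) (c : R) :
    (A + Matrix.single i₀ j₀ c).charpoly = A.charpoly -
      Polynomial.C c * (hessSeq (antiTranspose A) i₀.rev * hessSeq A j₀) := by
  have hB : IsULH (A + Matrix.single i₀ j₀ c) := by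
    have hji := hj₀.trans hi₀
    rw [Fin.le_def] at hji
    refine ⟨fun i j h => ?_, fun i j h => ?_⟩ <;>
    · rw [Matrix.add_apply, Matrix.single_apply_of_ne, add_zero]
      · first | exact hA.1 i j h | exact hA.2 i j h
      · rintro ⟨rfl, rfl⟩
        omega
  have hv : ∀ j : Fin n, j ≤ t → hessSeq (A + Matrix.single i₀ j₀ c) j = hessSeq A j := by
    refine fun j hj => hessSeq_congr t.isLt.le (fun i j hi => ?_) j hj
    rw [Matrix.add_apply, Matrix.single_apply_of_ne, add_zero]
    rintro ⟨rfl, rfl⟩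
    rw [Fin.le_def] at hi₀
    omega
  have hw : ∀ i : Fin n, t ≤ i → hessSeq (antiTranspose (A + Matrix.single i₀ j₀ c)) i.rev =
      hessSeq (antiTranspose A) i.rev := by
    refine fun i hi => hessSeq_congr (t := t.rev) t.rev.isLt.le (fun i j hi => ?_) i.rev
      (Fin.rev_le_rev.2 hi)
    simp only [antiTranspose]
    rw [Matrix.add_apply, Matrix.single_apply_of_ne, add_zero]
    rintro ⟨rfl, rfl⟩
    rw [Fin.le_def] at hj₀
    simp only [Fin.val_rev] at hj₀ hi
    omega
  rw [charpoly_eq_sum_block hB t, charpoly_eq_sum_block hA t, eq_sub_iff_add_eq,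
    ← sub_eq_zero, add_sub_right_comm]
  simp only [← Finset.sum_sub_distrib]
  rw [Finset.sum_eq_single i₀, Finset.sum_eq_single j₀]
  · simp only [if_pos (And.intro hi₀ hj₀), hv j₀ hj₀, hw i₀ hi₀, charmatrix_apply,
      Matrix.add_apply, Matrix.single_apply_same, map_add]
    ring
  · intro j _ hj
    split_ifs with h
    · rw [hv j h.2, hw i₀ h.1]
      simp [charmatrix_apply, hj.symm]
    · simp
  · simp
  · intro i _ hi
    refine Finset.sum_eq_zero fun j _ => ?_
    split_ifs with h
    · rw [hv j h.2, hw i h.1]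
      simp [charmatrix_apply, hi.symm]
    · simp
  · simp

end HessenbergSequence

lemma Polynomial.IsMonicOfDegree.eq_X_pow_of_dvd {F : Type*} [Field F] {p : F[X]} {d m : ℕ}
    (hp : IsMonicOfDegree p d) (h : p ∣ X ^ m) : p = X ^ d := by
  obtain ⟨e, -, he⟩ := (dvd_prime_pow prime_X m).1 h
  have heq := eq_of_monic_of_associated hp.monic (monic_X_pow e) he
  rw [heq, ← hp.natDegree_eq, heq, natDegree_X_pow]

section Superpattern

variable {F : Type*} [Field F] {n : ℕ} {r : Fin n → Fin n}

lemma CPos_injective (hr : ∀ k : Fin n, (k : ℕ) ≤ r k) : Function.Injective (CPos r) := by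
  intro k l h
  have hk := hr k
  have hl := hr l
  simp only [CPos, Prod.mk.injEq, Fin.mk.injEq] at h
  obtain ⟨h1, h2⟩ := h
  rw [h1] at h2 hk
  exact Fin.ext (by omega)

lemma CMat_apply_of_eq (hr : ∀ k : Fin n, (k : ℕ) ≤ r k) {k i j : Fin n}
    (h : CPos r k = (i, j)) : CMat F r i j = MvPolynomial.X k := by
  have hji : (j : ℕ) ≤ i := by
    simp only [CPos, Prod.mk.injEq] at h
    obtain ⟨rfl, rfl⟩ := h
    exact Nat.sub_le _ _
  rw [CMat, HMat, if_neg (by omega), zero_add, Finset.sum_eq_single k, if_pos h]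
  · intro l _ hl
    rw [if_neg]
    exact fun e => hl (CPos_injective hr (e.trans h.symm))
  · simp

lemma CMat_apply_of_ne {i j : Fin n} (h : ∀ k, CPos r k ≠ (i, j)) :
    CMat F r i j = if (j : ℕ) = i + 1 then 1 else 0 := by
  rw [CMat, HMat, Finset.sum_eq_zero fun k _ => if_neg (h k), add_zero]

lemma CPos_ne_of_lt {i j : Fin n} (h : i < j) (k : Fin n) : CPos r k ≠ (i, j) := by
  intro e
  simp only [CPos, Prod.mk.injEq] at e
  obtain ⟨rfl, rfl⟩ := e
  rw [Fin.lt_def] at h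
  simp only at h
  omega

variable {A : Matrix (Fin n) (Fin n) (MvPolynomial (Fin n) F)}

lemma IsULHSuperpatternOf.isULH (hA : IsULHSuperpatternOf A (CMat F r)) : IsULH A := by
  refine ⟨fun i j h => ?_, fun i j h => ?_⟩
  · rw [hA.1 i j (by omega), CMat_apply_of_ne (CPos_ne_of_lt (Fin.lt_def.2 (by omega))), if_pos h]
  · rw [hA.1 i j (by omega), CMat_apply_of_ne (CPos_ne_of_lt (Fin.lt_def.2 (by omega))),
      if_neg (by omega)]

lemma IsULHSuperpatternOf.apply_of_eq (hA : IsULHSuperpatternOf A (CMat F r))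
    (hr : ∀ k : Fin n, (k : ℕ) ≤ r k) {k i j : Fin n} (h : CPos r k = (i, j)) :
    A i j = MvPolynomial.X k := by
  have hji : (j : ℕ) ≤ i := by
    by_contra hlt
    exact CPos_ne_of_lt (not_le.1 hlt) k h
  rw [← CMat_apply_of_eq hr h]
  refine (hA.2 i j hji).resolve_right fun h' => MvPolynomial.X_ne_zero (R := F) k ?_
  rw [← CMat_apply_of_eq hr h, h'.1]

lemma IsULHSuperpatternOf.apply_of_ne (hA : IsULHSuperpatternOf A (CMat F r)) {i j : Fin n}
    (h : ∀ k, CPos r k ≠ (i, j)) : ∃ c : F, A i j = MvPolynomial.C c := by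
  have hC : ∃ c : F, CMat F r i j = MvPolynomial.C c := by
    rw [CMat_apply_of_ne h]
    split_ifs
    · exact ⟨1, MvPolynomial.C_1.symm⟩
    · exact ⟨0, MvPolynomial.C_0.symm⟩
  rcases lt_or_ge i j with hij | hij
  · rwa [hA.1 i j hij]
  · rcases hA.2 i j hij with h' | ⟨-, c, -, h'⟩
    · rwa [h']
    · exact ⟨c, h'⟩

lemma IsULH.map {R S : Type*} [Semiring R] [Semiring S] (f : R →+* S) {m : ℕ}
    {M : Matrix (Fin m) (Fin m) R} (hM : IsULH M) : IsULH (M.map f) :=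
  ⟨fun i j h => by rw [Matrix.map_apply, hM.1 i j h, map_one],
    fun i j h => by rw [Matrix.map_apply, hM.2 i j h, map_zero]⟩

lemma IsULHSuperpatternOf.map_eval_single (hA : IsULHSuperpatternOf A (CMat F r))
    (hr : ∀ k : Fin n, (k : ℕ) ≤ r k) (k : Fin n) :
    A.map (MvPolynomial.eval (Pi.single k 1)) =
      A.map (MvPolynomial.eval 0) + Matrix.single (CPos r k).1 (CPos r k).2 1 := by
  ext i j
  rw [Matrix.add_apply, Matrix.map_apply, Matrix.map_apply, Matrix.single_apply]
  by_cases h : ∃ l, CPos r l = (i, j)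
  · obtain ⟨l, hl⟩ := h
    rw [hA.apply_of_eq hr hl, MvPolynomial.eval_X, MvPolynomial.eval_X, Pi.zero_apply, zero_add]
    by_cases hkl : k = l
    · subst hkl
      rw [Pi.single_eq_same, if_pos (by rw [hl]; exact ⟨rfl, rfl⟩)]
    · rw [Pi.single_eq_of_ne (Ne.symm hkl), if_neg]
      exact fun e => hkl (CPos_injective hr ((Prod.ext e.1 e.2).trans hl.symm))
  · push Not at h
    obtain ⟨c, hc⟩ := hA.apply_of_ne h
    rw [hc, MvPolynomial.eval_C, MvPolynomial.eval_C, if_neg, add_zero]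
    exact fun e => h k (Prod.ext e.1 e.2)

lemma charpoly_map_eval (a : Fin n → F) (h : A.charpoly = Polynomial.X ^ n -
      ∑ k : Fin n, Polynomial.C (MvPolynomial.X k) * Polynomial.X ^ (n - 1 - (k : ℕ))) :
    (A.map (MvPolynomial.eval a)).charpoly = Polynomial.X ^ n -
      ∑ k : Fin n, Polynomial.C (a k) * Polynomial.X ^ (n - 1 - (k : ℕ)) := by
  rw [Matrix.charpoly_map, h]
  simp [Polynomial.map_sub, Polynomial.map_sum]

lemma IsULHSuperpatternOf.hessSeq_mul_hessSeq (hA : IsULHSuperpatternOf A (CMat F r))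
    (hr : ∀ k : Fin n, (k : ℕ) ≤ r k) (h : A.charpoly = Polynomial.X ^ n -
      ∑ k : Fin n, Polynomial.C (MvPolynomial.X k) * Polynomial.X ^ (n - 1 - (k : ℕ)))
    {t : Fin n} (k : Fin n) (hi : t ≤ (CPos r k).1) (hj : (CPos r k).2 ≤ t) :
    hessSeq (antiTranspose (A.map (MvPolynomial.eval 0))) (CPos r k).1.rev *
      hessSeq (A.map (MvPolynomial.eval 0)) (CPos r k).2 = X ^ (n - 1 - (k : ℕ)) := by
  have hs := charpoly_add_single (hA.isULH.map (MvPolynomial.eval 0)) hi hj 1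
  rw [← hA.map_eval_single hr, charpoly_map_eval _ h, charpoly_map_eval _ h,
    Finset.sum_eq_single k] at hs
  · simpa using hs.symm
  · intro l _ hl
    rw [Pi.single_eq_of_ne hl, Polynomial.C_0, zero_mul]
  · simp

lemma eq_of_sum_C_mul_X_pow_eq {R : Type*} [CommRing R] {f g : Fin n → R}
    (h : ∑ k : Fin n, Polynomial.C (f k) * X ^ (n - 1 - (k : ℕ)) =
      ∑ k : Fin n, Polynomial.C (g k) * X ^ (n - 1 - (k : ℕ))) : f = g := by
  have hcoeff : ∀ (f : Fin n → R) (k : Fin n),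
      (∑ l : Fin n, Polynomial.C (f l) * X ^ (n - 1 - (l : ℕ)) : R[X]).coeff (n - 1 - k) =
        f k := by
    intro f k
    simp only [finsetSum_coeff, coeff_C_mul, coeff_X_pow]
    rw [Finset.sum_eq_single k]
    · simp
    · intro l _ hl
      rw [if_neg, mul_zero]
      exact fun e => hl (Fin.ext (by omega))
    · simp
  funext k
  rw [← hcoeff f k, h, hcoeff]

end Superpattern

/-- A matrix `A ∈ 𝒢̃` is a companion matrix iff `A ∈ 𝒢̂` (all
nonzero entries of `A` are superdiagonal ones or lie in the `i₁`-block) and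
`s_{k−1}(A) = xₖ` for every `k = 1,…,n`. -/
theorem mem_Gtilde_isCompanion_iff {F : Type*} [Field F] {n : ℕ} (hn : 0 < n)
    (r : Fin n → Fin n) (hr : IsGIdx hn r)
    (A : Matrix (Fin n) (Fin n) (MvPolynomial (Fin n) F))
    (hA : IsULHSuperpatternOf A (CMat F r)) :
    IsCompanion A ↔
      ((∀ i j : Fin n, A i j ≠ 0 →
        ((j : ℕ) = (i : ℕ) + 1 ∨ ((r ⟨0, hn⟩ : ℕ) ≤ (i : ℕ) ∧ (j : ℕ) ≤ (r ⟨0, hn⟩ : ℕ)))) ∧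
      ∀ k : Fin n, subdiagSum A (k : ℕ) = MvPolynomial.X k) := by
  have hrk : ∀ k : Fin n, (k : ℕ) ≤ r k := fun k => (hr.1 k).1
  have hULH := hA.isULH
  set t := r ⟨0, hn⟩
  have hrow : ∀ k : Fin n, t ≤ (CPos r k).1 := fun k => (hr.1 k).2.2
  have hcol : ∀ k : Fin n, (CPos r k).2 ≤ t := fun k => (hr.1 k).2.1
  constructor
  · rintro ⟨-, hchar⟩
    set B := A.map (MvPolynomial.eval (0 : Fin n → F)) with hB
    have hmul := fun k => hA.hessSeq_mul_hessSeq hrk hchar k (hrow k) (hcol k)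
    have hv : ∀ j ≤ (t : ℕ), hessSeq B j = X ^ j := by
      intro j hj
      obtain ⟨k, hk⟩ := (hr.2.2 ⟨j, by omega⟩).2 hj
      refine (hessSeq_isMonicOfDegree B j (by omega)).eq_X_pow_of_dvd (m := n - 1 - k) ?_
      rw [← hmul k, ← show ((CPos r k).2 : ℕ) = j from hk]
      exact dvd_mul_left _ _
    have hw : ∀ i ≤ (t.rev : ℕ), hessSeq (antiTranspose B) i = X ^ i := by
      intro i hi
      have hin : i < n := by omega
      obtain ⟨k, hk⟩ := (hr.2.1 (Fin.rev ⟨i, hin⟩)).2 (by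
        simp only [Fin.val_rev] at hi ⊢
        omega)
      refine (hessSeq_isMonicOfDegree _ i hin.le).eq_X_pow_of_dvd (m := n - 1 - k) ?_
      have hrev : ((CPos r k).1.rev : ℕ) = i := by
        rw [show (CPos r k).1 = Fin.rev ⟨i, hin⟩ from hk, Fin.rev_rev]
      rw [← hmul k, hrev]
      exact dvd_mul_right _ _
    have hzero : ∀ i j : Fin n, (∀ k, CPos r k ≠ (i, j)) → B i j = 0 → A i j = 0 := by
      intro i j hne h0
      obtain ⟨c, hc⟩ := hA.apply_of_ne hne
      rw [hB, Matrix.map_apply, hc, MvPolynomial.eval_C] at h0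
      rw [hc, h0, MvPolynomial.C_0]
    have hblock : ∀ i j : Fin n, A i j ≠ 0 → ((j : ℕ) = i + 1 ∨ (t ≤ i ∧ j ≤ t)) := by
      intro i j hne
      rcases lt_or_ge i j with hij | hji
      · by_contra hnot
        rw [Fin.lt_def] at hij
        exact hne (hULH.2 i j (by omega))
      · refine Or.inr ⟨?_, ?_⟩
        · by_contra hit
          refine hne (hzero i j (fun k e => hit ?_)
            (eq_zero_of_hessSeq_eq_X_pow hv i j (not_le.1 hit) hji))
          simpa [e] using hrow k
        · by_contra hjt
          refine hne (hzero i j (fun k e => hjt ?_) ?_)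
          · simpa [e] using hcol k
          · have := eq_zero_of_hessSeq_eq_X_pow hw j.rev i.rev
              (Fin.rev_lt_rev.2 (not_le.1 hjt)) (Fin.rev_le_rev.2 hji)
            simpa [antiTranspose] using this
    refine ⟨hblock, fun k => ?_⟩
    rw [charpoly_eq_of_block_support hULH t hblock, sub_right_inj] at hchar
    exact congrFun (eq_of_sum_C_mul_X_pow_eq
      (f := fun k : Fin n => subdiagSum A k) hchar) k
  · rintro ⟨hblock, hsum⟩
    refine ⟨⟨CPos r, CPos_injective hrk, fun k => hA.apply_of_eq hrk rfl,
      fun i j hne => hA.apply_of_ne hne⟩, ?_⟩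
    rw [charpoly_eq_of_block_support hULH t hblock]
    simp only [← hsum, subdiagSum]
end
end

section
/- Let A be a ULH superpattern of B_{(i_1,j_1),…,(i_n,j_n)} ∈ ℬ. Then the characteristic polynomial of A satisfies det(λI_n − A) = P_{A_0}(λ) − Σ_{k=1}^{n} x_k · P_{A[1,…,j_k−1]}(λ) · P_{A[i_k+1,…,n]}(λ), where A_0 is the constant part of A and P_M denotes the characteristic polynomial of M; in particular, det(λI_n − A) = p_n(λ) − x_1 p_{n−1}(λ) − ⋯ − x_n p_0(λ) where p_n(λ), p_{n−1}(λ), …, p_0(λ) are monic polynomials with coefficients in F of degree at most n. -/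
open Polynomial Matrix

noncomputable section

/-- The minor of order `m` of an infinite matrix on the consecutive rows and columns
`a, …, a + m − 1`. -/
def consecutiveMinor {R : Type*} [CommRing R] (N : ℕ → ℕ → R) (a m : ℕ) : R :=
  (Matrix.of fun i j : Fin m => N (a + i) (a + j)).det

/-- A lower Hessenberg infinite matrix with all superdiagonal entries `-1`. -/
def IsNegULH {R : Type*} [CommRing R] (N : ℕ → ℕ → R) : Prop :=
  (∀ i, N i (i + 1) = -1) ∧ ∀ i j, i + 1 < j → N i j = 0

@[simp]
theorem consecutiveMinor_zero {R : Type*} [CommRing R] (N : ℕ → ℕ → R) (a : ℕ) :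
    consecutiveMinor N a 0 = 1 := by
  simp [consecutiveMinor]

/-- Expansion of a Hessenberg determinant along its last row. -/
theorem IsNegULH.consecutiveMinor_succ {R : Type*} [CommRing R] {N : ℕ → ℕ → R}
    (hN : IsNegULH N) (a m : ℕ) :
    consecutiveMinor N a (m + 1) =
      ∑ j ∈ Finset.range (m + 1), N (a + m) (a + j) * consecutiveMinor N a j := by
  induction m using Nat.strong_induction_on with
  | _ m ih =>
    set s := ∑ j ∈ Finset.range (m + 1), N (a + m) (a + j) * consecutiveMinor N a j with hs
    set M : Matrix (Fin (m + 1)) (Fin (m + 1)) R := Matrix.of fun i j => N (a + i) (a + j) with hM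
    have hcol : ∀ i : Fin (m + 1), ∑ j : Fin (m + 1), consecutiveMinor N a j • M i j =
        if i = Fin.last m then s else 0 := by
      intro i
      have hsum : ∑ j : Fin (m + 1), consecutiveMinor N a j • M i j =
          ∑ j ∈ Finset.range (m + 1), N (a + i) (a + j) * consecutiveMinor N a j := by
        rw [← Fin.sum_univ_eq_sum_range
          (fun j => N (a + i) (a + j) * consecutiveMinor N a j)]
        simp [hM, mul_comm]
      rw [hsum]
      split_ifs with h
      · rw [h, hs, Fin.val_last]
      · have hi : (i : ℕ) < m := Fin.val_lt_last h
        obtain ⟨d, hd⟩ := Nat.exists_eq_add_of_lt hi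
        have hm : m + 1 = ((i : ℕ) + 1 + 1) + d := by omega
        rw [congrArg Finset.range hm, Finset.sum_range_add, Finset.sum_range_succ, ← ih i hi,
          ← add_assoc a, hN.1, Finset.sum_eq_zero (s := Finset.range d)]
        · ring
        · intro x _
          rw [hN.2 _ _ (by omega), zero_mul]
    have hdet := Matrix.det_updateCol_sum M 0 (fun j => consecutiveMinor N a j)
    simp only [Fin.val_zero, consecutiveMinor_zero, one_smul] at hdet
    change M.det = s
    rw [← hdet, Matrix.det_succ_column_zero, Finset.sum_eq_single (Fin.last m)]
    · have hminor : ((M.updateCol 0 fun k => ∑ j : Fin (m + 1), consecutiveMinor N a j • M k j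
          ).submatrix (Fin.last m).succAbove Fin.succ).det = (-1) ^ m := by
        rw [Matrix.det_of_isLowerTriangular]
        · simp [hM, Fin.succ_ne_zero, ← add_assoc, hN.1]
        · intro i j hij
          have : (i : ℕ) < j := hij
          simpa [hM, Fin.succ_ne_zero] using hN.2 _ _ (by omega)
      rw [hminor, Matrix.updateCol_self, hcol, if_pos rfl, Fin.val_last,
        mul_right_comm, ← pow_add, Even.neg_one_pow ⟨m, rfl⟩, one_mul]
    · intro i _ hi
      rw [Matrix.updateCol_self, hcol, if_neg hi]
      ring
    · simp

/-- Lowering the entries of a Hessenberg matrix by `x k` at positions `(r k, c k)` lying in a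
common block changes its leading minors by an expression linear in the `x k`. -/
theorem IsNegULH.consecutiveMinor_sub {R ι : Type*} [CommRing R] [Fintype ι] {N N₀ : ℕ → ℕ → R}
    (hN : IsNegULH N) (hN₀ : IsNegULH N₀) (r c : ι → ℕ) (x : ι → R)
    (hrc : ∀ k l, c k ≤ r l)
    (hsub : ∀ i j, N i j = N₀ i j - ∑ k, if r k = i ∧ c k = j then x k else 0) (m : ℕ) :
    consecutiveMinor N 0 m = consecutiveMinor N₀ 0 m -
      ∑ k, if r k < m then
        x k * (consecutiveMinor N 0 (c k) * consecutiveMinor N (r k + 1) (m - 1 - r k)) else 0 := by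
  induction m using Nat.strong_induction_on with
  | _ m ih =>
    rcases m with _ | m
    · simp
    have hlead : ∀ k, c k < m + 1 → consecutiveMinor N 0 (c k) = consecutiveMinor N₀ 0 (c k) := by
      intro k hk
      rw [ih _ hk, Finset.sum_eq_zero, sub_zero]
      intro l _
      rw [if_neg (by have := hrc k l; omega)]
    have hstep : ∀ k, (∑ j ∈ Finset.range (m + 1), N m j * (if r k < j then
          x k * (consecutiveMinor N 0 (c k) * consecutiveMinor N (r k + 1) (j - 1 - r k))
          else 0)) + (if r k = m then x k * consecutiveMinor N₀ 0 (c k) else 0) =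
        if r k < m + 1 then
          x k * (consecutiveMinor N 0 (c k) * consecutiveMinor N (r k + 1) (m - r k)) else 0 := by
      intro k
      rcases lt_trichotomy (r k) m with h | h | h
      · obtain ⟨d, hd⟩ := Nat.exists_eq_add_of_lt h
        rw [if_neg h.ne, if_pos (by omega), show m - r k = d + 1 by omega,
          hN.consecutiveMinor_succ, show m + 1 = (r k + 1) + (d + 1) by omega,
          Finset.sum_range_add, Finset.sum_eq_zero (s := Finset.range (r k + 1)), zero_add,
          add_zero, Finset.mul_sum, Finset.mul_sum]
        · refine Finset.sum_congr rfl fun j _ => ?_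
          rw [if_pos (by omega), show r k + 1 + j - 1 - r k = j by omega,
            show r k + 1 + d = m by omega]
          ring
        · intro j hj
          rw [Finset.mem_range] at hj
          rw [if_neg (by omega), mul_zero]
      · rw [if_pos h, if_pos (by omega), h, Nat.sub_self, consecutiveMinor_zero, mul_one,
          hlead k (by have := hrc k k; omega), Finset.sum_eq_zero, zero_add]
        intro j hj
        rw [Finset.mem_range] at hj
        rw [if_neg (by omega), mul_zero]
      · rw [if_neg h.ne', if_neg (by omega), add_zero]
        refine Finset.sum_eq_zero fun j hj => ?_
        rw [Finset.mem_range] at hj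
        rw [if_neg (by omega), mul_zero]
    have hpert : ∑ j ∈ Finset.range (m + 1),
        (∑ k, if r k = m ∧ c k = j then x k else 0) * consecutiveMinor N₀ 0 j =
        ∑ k, if r k = m then x k * consecutiveMinor N₀ 0 (c k) else 0 := by
      simp only [Finset.sum_mul]
      rw [Finset.sum_comm]
      refine Finset.sum_congr rfl fun k _ => ?_
      split_ifs with h
      · rw [Finset.sum_eq_single (c k)]
        · simp [h]
        · intro j _ hj
          simp [hj.symm]
        · intro hj
          exact absurd (Finset.mem_range.2 (by have := hrc k k; omega)) hj
      · simp [h]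
    simp only [Nat.add_sub_cancel, ← hstep, Finset.sum_add_distrib]
    rw [Finset.sum_comm, ← hpert, hN.consecutiveMinor_succ, hN₀.consecutiveMinor_succ,
      ← Finset.sum_add_distrib, ← Finset.sum_sub_distrib]
    refine Finset.sum_congr rfl fun j hj => ?_
    rw [Finset.mem_range] at hj
    rw [← Finset.mul_sum, zero_add, zero_add, ih j hj, hsub m j]
    ring

/-- Extend the characteristic matrix of `A` to an infinite matrix, continuing the
superdiagonal by `-1`. -/
def extCharmatrix {R : Type*} [CommRing R] {n : ℕ} (A : Matrix (Fin n) (Fin n) R) (i j : ℕ) :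
    R[X] :=
  if h : i < n ∧ j < n then A.charmatrix ⟨i, h.1⟩ ⟨j, h.2⟩ else if j = i + 1 then -1 else 0

theorem isNegULH_extCharmatrix {R : Type*} [CommRing R] {n : ℕ} {A : Matrix (Fin n) (Fin n) R}
    (hA : IsULH A) : IsNegULH (extCharmatrix A) := by
  constructor
  · intro i
    unfold extCharmatrix
    rw [if_pos rfl]
    split_ifs with h
    · rw [Matrix.charmatrix_apply_ne _ _ _ (by simp), hA.1 _ _ rfl, Polynomial.C_1]
    · rfl
  · intro i j hij
    unfold extCharmatrix
    rw [if_neg hij.ne']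
    split_ifs with h
    · rw [Matrix.charmatrix_apply_ne _ _ _ (by simp; omega), hA.2 _ _ hij, Polynomial.C_0, neg_zero]
    · rfl

theorem charpoly_submatrix_eq_consecutiveMinor {R : Type*} [CommRing R] {n : ℕ}
    (A : Matrix (Fin n) (Fin n) R) (a m : ℕ) (f : Fin m → Fin n) (hf : ∀ i, (f i : ℕ) = a + i) :
    (A.submatrix f f).charpoly = consecutiveMinor (extCharmatrix A) a m := by
  unfold consecutiveMinor Matrix.charpoly
  congr 1
  ext1 i j
  have hi : (⟨a + i, hf i ▸ (f i).isLt⟩ : Fin n) = f i := Fin.ext (hf i).symm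
  have hj : (⟨a + j, hf j ▸ (f j).isLt⟩ : Fin n) = f j := Fin.ext (hf j).symm
  rw [Matrix.of_apply, extCharmatrix, dif_pos ⟨hf i ▸ (f i).isLt, hf j ▸ (f j).isLt⟩, hi, hj,
    Matrix.charmatrix_apply, Matrix.charmatrix_apply, Matrix.submatrix_apply,
    Matrix.diagonal_apply, Matrix.diagonal_apply]
  simp only [Fin.ext_iff, hf, add_right_inj]

/-- Each entry of a ULH superpattern is the sum of its constant part and its variable part. -/
theorem IsULHSuperpatternOf.apply_eq {F : Type*} [Field F] {n : ℕ}
    {pos : Fin n → Fin n × Fin n} (hpos : ∀ k, ((pos k).2 : ℕ) ≤ ((pos k).1 : ℕ))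
    {A : Matrix (Fin n) (Fin n) (MvPolynomial (Fin n) F)}
    (hA : IsULHSuperpatternOf A (HMat F pos)) (i j : Fin n) :
    A i j = MvPolynomial.C (constPart A i j) +
      ∑ k : Fin n, if pos k = (i, j) then MvPolynomial.X k else 0 := by
  have heval : MvPolynomial.eval (fun _ => (0 : F))
      (∑ k : Fin n, if pos k = (i, j) then MvPolynomial.X k else 0) = 0 := by
    rw [map_sum]
    refine Finset.sum_eq_zero fun k _ => ?_
    split_ifs <;> simp
  rcases lt_or_ge (i : ℕ) (j : ℕ) with h | h
  · have hsum : (∑ k : Fin n, if pos k = (i, j) then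
        (MvPolynomial.X k : MvPolynomial (Fin n) F) else 0) = 0 := by
      refine Finset.sum_eq_zero fun k _ => if_neg fun hk => ?_
      have := hpos k
      rw [hk] at this
      exact absurd this (by simpa using h)
    rw [constPart, Matrix.map_apply, hA.1 i j h, HMat, hsum]
    split_ifs <;> simp
  · have hH : HMat F pos i j = ∑ k : Fin n, if pos k = (i, j) then MvPolynomial.X k else 0 := by
      rw [HMat, if_neg (by omega), zero_add]
    rcases hA.2 i j h with hij | ⟨hz, c, _, hc⟩
    · rw [constPart, Matrix.map_apply, hij, hH, heval, map_zero, zero_add]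
    · rw [← hH, hz, constPart, Matrix.map_apply, hc, MvPolynomial.eval_C, add_zero]

theorem IsULHSuperpatternOf.isULH_s11 {F : Type*} [Field F] {n : ℕ}
    {pos : Fin n → Fin n × Fin n} (hpos : ∀ k, ((pos k).2 : ℕ) ≤ ((pos k).1 : ℕ))
    {A : Matrix (Fin n) (Fin n) (MvPolynomial (Fin n) F)}
    (hA : IsULHSuperpatternOf A (HMat F pos)) : IsULH A := by
  have hsum : ∀ i j : Fin n, (i : ℕ) < j → (∑ k : Fin n, if pos k = (i, j) then
      (MvPolynomial.X k : MvPolynomial (Fin n) F) else 0) = 0 := by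
    intro i j h
    refine Finset.sum_eq_zero fun k _ => if_neg fun hk => ?_
    have := hpos k
    rw [hk] at this
    exact absurd this (by simpa using h)
  constructor
  · intro i j h
    rw [hA.1 i j (by omega), HMat, if_pos h, hsum i j (by omega), add_zero]
  · intro i j h
    rw [hA.1 i j (by omega), HMat, if_neg (by omega), hsum i j (by omega), add_zero]

theorem isULH_map_constPart {F : Type*} [Field F] {n : ℕ}
    {A : Matrix (Fin n) (Fin n) (MvPolynomial (Fin n) F)} (hA : IsULH A) :
    IsULH ((constPart A).map (MvPolynomial.C : F →+* MvPolynomial (Fin n) F)) := by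
  constructor
  · intro i j h
    simp [constPart, hA.1 i j h]
  · intro i j h
    simp [constPart, hA.2 i j h]

/-- A principal submatrix containing no variable position equals its constant part. -/
theorem IsULHSuperpatternOf.submatrix_eq_map {F : Type*} [Field F] {n m : ℕ}
    {pos : Fin n → Fin n × Fin n} (hpos : ∀ k, ((pos k).2 : ℕ) ≤ ((pos k).1 : ℕ))
    {A : Matrix (Fin n) (Fin n) (MvPolynomial (Fin n) F)}
    (hA : IsULHSuperpatternOf A (HMat F pos)) (f : Fin m → Fin n)
    (hf : ∀ i j k, pos k ≠ (f i, f j)) :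
    A.submatrix f f = ((constPart A).submatrix f f).map
      (MvPolynomial.C : F →+* MvPolynomial (Fin n) F) := by
  ext1 i j
  rw [Matrix.map_apply, Matrix.submatrix_apply, Matrix.submatrix_apply, hA.apply_eq hpos,
    Finset.sum_eq_zero fun k _ => if_neg (hf i j k), add_zero]

/-- For a ULH superpattern `A` of `B_{(i₁,j₁),…,(iₙ,jₙ)} ∈ ℬ`,
`det(λI − A) = P_{A₀}(λ) − Σₖ xₖ · P_{A[1,…,jₖ−1]}(λ) · P_{A[iₖ+1,…,n]}(λ)`; in
particular `det(λI − A) = pₙ(λ) − x₁p_{n−1}(λ) − ⋯ − xₙp₀(λ)` for monic polynomials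
`pₙ,…,p₀` with coefficients in `F` of degree at most `n`. -/
theorem charpoly_of_mem_Btilde {F : Type*} [Field F] {n : ℕ} (hn : 0 < n)
    (pos : Fin n → Fin n × Fin n) (hpos : IsBPos pos)
    (A : Matrix (Fin n) (Fin n) (MvPolynomial (Fin n) F))
    (hA : IsULHSuperpatternOf A (HMat F pos)) :
    A.charpoly =
      ((constPart A).charpoly).map (MvPolynomial.C : F →+* MvPolynomial (Fin n) F) -
      ∑ k : Fin n, Polynomial.C (MvPolynomial.X k) *
        ((leadSub A ((pos k).2 : ℕ) ((pos k).2).isLt.le).charpoly *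
         (trailSub A (n - 1 - ((pos k).1 : ℕ)) (by omega)).charpoly) ∧
    ∃ p : Fin (n + 1) → Polynomial F,
      (∀ i, (p i).Monic) ∧ (∀ i, (p i).natDegree ≤ n) ∧
      A.charpoly =
        (p ⟨n, n.lt_succ_self⟩).map (MvPolynomial.C : F →+* MvPolynomial (Fin n) F) -
        ∑ k : Fin n, Polynomial.C (MvPolynomial.X k) *
          (p ⟨n - 1 - (k : ℕ), by omega⟩).map
            (MvPolynomial.C : F →+* MvPolynomial (Fin n) F) := by
  have hle := hpos.1.1
  have hULH := hA.isULH_s11 hle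
  have hformula : A.charpoly =
      ((constPart A).charpoly).map (MvPolynomial.C : F →+* MvPolynomial (Fin n) F) -
      ∑ k : Fin n, Polynomial.C (MvPolynomial.X k) *
        ((leadSub A ((pos k).2 : ℕ) ((pos k).2).isLt.le).charpoly *
         (trailSub A (n - 1 - ((pos k).1 : ℕ)) (by omega)).charpoly) := by
    have hmain := (isNegULH_extCharmatrix hULH).consecutiveMinor_sub
      (isNegULH_extCharmatrix (isULH_map_constPart hULH))
      (fun k => ((pos k).1 : ℕ)) (fun k => ((pos k).2 : ℕ))
      (fun k => Polynomial.C (MvPolynomial.X k)) hpos.2 (by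
        intro i j
        unfold extCharmatrix
        by_cases h : i < n ∧ j < n
        · rw [dif_pos h, dif_pos h, Matrix.charmatrix_apply, Matrix.charmatrix_apply,
            hA.apply_eq hle, Matrix.map_apply, map_add, map_sum, sub_add_eq_sub_sub]
          congr 1
          refine Finset.sum_congr rfl fun k _ => ?_
          rw [apply_ite Polynomial.C, Polynomial.C_0]
          simp only [Prod.ext_iff, Fin.ext_iff]
        · rw [dif_neg h, dif_neg h, Finset.sum_eq_zero, sub_zero]
          rintro k _
          refine if_neg ?_
          rintro ⟨rfl, rfl⟩
          exact h ⟨(pos k).1.isLt, (pos k).2.isLt⟩) n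
    rw [← charpoly_submatrix_eq_consecutiveMinor _ 0 n id (by simp),
      ← charpoly_submatrix_eq_consecutiveMinor _ 0 n id (by simp),
      Matrix.submatrix_id_id, Matrix.submatrix_id_id, Matrix.charpoly_map] at hmain
    rw [hmain]
    congr 1
    refine Finset.sum_congr rfl fun k _ => ?_
    rw [if_pos (pos k).1.isLt, leadSub, trailSub,
      charpoly_submatrix_eq_consecutiveMinor A 0 _ _ (by simp),
      charpoly_submatrix_eq_consecutiveMinor A ((pos k).1 + 1) _ _ (by
        intro i
        have := (pos k).1.isLt
        simp only
        omega)]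
  obtain ⟨q, hq_monic, hq_deg, hq⟩ : ∃ q : Fin n → F[X],
      (∀ k, (q k).Monic) ∧ (∀ k, (q k).natDegree ≤ n) ∧
      ∀ k, (leadSub A ((pos k).2 : ℕ) ((pos k).2).isLt.le).charpoly *
         (trailSub A (n - 1 - ((pos k).1 : ℕ)) (by omega)).charpoly =
        (q k).map (MvPolynomial.C : F →+* MvPolynomial (Fin n) F) := by
    refine ⟨fun k => (leadSub (constPart A) ((pos k).2 : ℕ) ((pos k).2).isLt.le).charpoly *
      (trailSub (constPart A) (n - 1 - ((pos k).1 : ℕ)) (by omega)).charpoly,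
      fun k => (Matrix.charpoly_monic _).mul (Matrix.charpoly_monic _), fun k => ?_, fun k => ?_⟩
    · refine Polynomial.natDegree_mul_le.trans ?_
      rw [Matrix.charpoly_natDegree_eq_dim, Matrix.charpoly_natDegree_eq_dim, Fintype.card_fin,
        Fintype.card_fin]
      have := hle k
      omega
    · rw [Polynomial.map_mul, ← Matrix.charpoly_map, ← Matrix.charpoly_map]
      congr 2
      · refine hA.submatrix_eq_map hle _ fun i j l h => ?_
        have hl := hpos.2 k l
        rw [h, Fin.val_castLE] at hl
        omega
      · refine hA.submatrix_eq_map hle _ fun i j l h => ?_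
        have hl := hpos.2 l k
        rw [h] at hl
        have := (pos k).1.isLt
        simp only at hl
        omega
  refine ⟨hformula, fun m => if (m : ℕ) = n then (constPart A).charpoly else
    q ⟨n - 1 - m, by omega⟩, fun m => ?_, fun m => ?_, ?_⟩
  · dsimp only
    split_ifs
    exacts [Matrix.charpoly_monic _, hq_monic _]
  · dsimp only
    split_ifs
    exacts [by simp [Matrix.charpoly_natDegree_eq_dim], hq_deg _]
  · beta_reduce
    rw [hformula, if_pos rfl]
    refine sub_right_inj.2 (Finset.sum_congr rfl fun k _ => ?_)
    have hk : (⟨n - 1 - (n - 1 - (k : ℕ)), by omega⟩ : Fin n) = k :=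
      Fin.ext (Nat.sub_sub_self (by omega))
    rw [if_neg (by simp only; omega), hk, hq]
end
end

section
/- Let A be a ULH superpattern of B_{(i_1,j_1),…,(i_n,j_n)} ∈ ℬ, and write det(λI_n − A) = p_n(λ) − x_1 p_{n−1}(λ) − ⋯ − x_n p_0(λ) with p_n = P_{A_0} and p_{n−k} = P_{A[1,…,j_k−1]} · P_{A[i_k+1,…,n]} for k = 1,…,n. Then deg p_n(λ) = n, deg p_{n−k}(λ) = n − i_k + j_k − 1 for k = 1,…,n, and the degrees are nonincreasing: n = deg p_n(λ) ≥ deg p_{n−1}(λ) ≥ ⋯ ≥ deg p_0(λ). -/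
open Polynomial Matrix

noncomputable section

/-- For a ULH superpattern `A` of `B_{(i₁,j₁),…,(iₙ,jₙ)} ∈ ℬ`,
writing `pₙ = P_{A₀}` and `p_{n−k} = P_{A[1,…,jₖ−1]} · P_{A[iₖ+1,…,n]}`, one has
`deg pₙ = n`, `deg p_{n−k} = n − iₖ + jₖ − 1`, and
`n = deg pₙ ≥ deg p_{n−1} ≥ ⋯ ≥ deg p₀`. -/
theorem degrees_of_mem_Btilde {F : Type*} [Field F] {n : ℕ} (hn : 0 < n)
    (pos : Fin n → Fin n × Fin n) (hpos : IsBPos pos)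
    (A : Matrix (Fin n) (Fin n) (MvPolynomial (Fin n) F))
    (hA : IsULHSuperpatternOf A (HMat F pos))
    (P : Fin n → Polynomial (MvPolynomial (Fin n) F))
    (hP : ∀ k : Fin n, P k =
      (leadSub A ((pos k).2 : ℕ) ((pos k).2).isLt.le).charpoly *
      (trailSub A (n - 1 - ((pos k).1 : ℕ)) (by omega)).charpoly) :
    ((constPart A).charpoly).natDegree = n ∧
    (∀ k : Fin n, (P k).natDegree = ((pos k).2 : ℕ) + (n - 1 - ((pos k).1 : ℕ))) ∧
    (∀ k : Fin n, (P k).natDegree ≤ n) ∧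
    (∀ k l : Fin n, k ≤ l → (P l).natDegree ≤ (P k).natDegree) := by
  have degree_P (k : Fin n) :
      (P k).natDegree = ((pos k).2 : ℕ) + (n - 1 - ((pos k).1 : ℕ)) := by
    rw [hP k, (charpoly_monic _).natDegree_mul (charpoly_monic _),
      charpoly_natDegree_eq_dim, charpoly_natDegree_eq_dim, Fintype.card_fin, Fintype.card_fin]
  refine ⟨by rw [charpoly_natDegree_eq_dim, Fintype.card_fin], degree_P, fun k => ?_,
    fun k l hkl => ?_⟩
  · have := hpos.1.1 k
    rw [degree_P]
    omega
  · rcases hkl.eq_or_lt with rfl | hlt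
    · rfl
    · have hk := hpos.1.1 k
      have hl := hpos.1.1 l
      have hprec := hpos.1.2 k l hlt
      unfold Prec at hprec
      rw [degree_P, degree_P]
      omega
end
end

section
/- Let A be a ULH superpattern of B_{(i_1,j_1),…,(i_n,j_n)} ∈ ℬ, with det(λI_n − A) = p_n(λ) − x_1 p_{n−1}(λ) − ⋯ − x_n p_0(λ) where p_n = P_{A_0} and p_{n−k} = P_{A[1,…,j_k−1]} · P_{A[i_k+1,…,n]}. If A is PB-companion, then deg p_{n−k}(λ) ≥ n − k for every k = 0, 1, …, n. -/
open Polynomial Matrix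

noncomputable section

/-- If every nonzero entry `(a, b)` of a polynomial matrix has degree at most `r a - c b`, then its
determinant has degree at most `∑ r - ∑ c`. -/
theorem Matrix.natDegree_det_le_of_weights {R ι : Type*} [CommRing R] [Fintype ι] [DecidableEq ι]
    (M : Matrix ι ι R[X]) (r c : ι → ℕ)
    (h : ∀ a b, M a b ≠ 0 → (M a b).natDegree + c b ≤ r a) :
    M.det.natDegree ≤ ∑ a, r a - ∑ b, c b := by
  rw [Matrix.det_apply]
  refine Polynomial.natDegree_sum_le_of_forall_le _ _ fun σ _ => ?_
  refine (Polynomial.natDegree_smul_le _ _).trans ?_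
  by_cases hz : ∃ i, M (σ i) i = 0
  · obtain ⟨i, hi⟩ := hz
    have hprod : ∏ i, M (σ i) i = 0 := Finset.prod_eq_zero (Finset.mem_univ i) hi
    simp [hprod]
  · push Not at hz
    refine (Polynomial.natDegree_prod_le _ _).trans ?_
    have hsum := Finset.sum_le_sum fun i (_ : i ∈ Finset.univ) => h (σ i) i (hz i)
    rw [Finset.sum_add_distrib, Equiv.sum_comp σ r] at hsum
    exact Nat.le_sub_of_add_le hsum

/-- The cofactor of a lower Hessenberg matrix at a position on the `(i - j)`-subdiagonal has
degree at most `n - 1 - (i - j)` in the characteristic matrix. -/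
theorem natDegree_det_updateRow_charmatrix_le {R : Type*} [CommRing R] {n : ℕ}
    (M : Matrix (Fin n) (Fin n) R) (hM : ∀ a b : Fin n, (a : ℕ) + 1 < (b : ℕ) → M a b = 0)
    (i j : Fin n) (hij : (j : ℕ) ≤ (i : ℕ)) :
    ((M.charmatrix.updateRow i (Pi.single j 1)).det).natDegree ≤
      n - 1 - ((i : ℕ) - (j : ℕ)) := by
  have hr : ∑ a, (if a = i then (j : ℕ) else (a : ℕ) + 1) + ((i : ℕ) + 1) =
      ∑ a : Fin n, (a : ℕ) + n + (j : ℕ) := by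
    have hsucc : ∑ a : Fin n, ((a : ℕ) + 1) = ∑ a : Fin n, (a : ℕ) + n := by
      simp [Finset.sum_add_distrib]
    rw [← hsucc, ← Finset.add_sum_erase _ _ (Finset.mem_univ i),
      ← Finset.add_sum_erase _ (fun a : Fin n => (a : ℕ) + 1) (Finset.mem_univ i), if_pos rfl,
      Finset.sum_congr rfl fun a ha => if_neg (Finset.ne_of_mem_erase ha)]
    omega
  refine (Matrix.natDegree_det_le_of_weights _ (fun a => if a = i then (j : ℕ) else (a : ℕ) + 1)
    (fun b => (b : ℕ)) fun a b hab => ?_).trans (by omega)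
  by_cases ha : a = i
  · subst ha
    rw [Matrix.updateRow_self] at hab ⊢
    obtain rfl : b = j := by
      by_contra hb
      exact hab (Pi.single_eq_of_ne hb _)
    simp
  · rw [Matrix.updateRow_ne ha] at hab ⊢
    rw [if_neg ha]
    by_cases hEq : a = b
    · subst hEq
      rw [Matrix.charmatrix_apply_eq]
      have := Polynomial.natDegree_X_sub_C_le (M a a)
      omega
    · rw [Matrix.charmatrix_apply_ne _ _ _ hEq] at hab ⊢
      rw [← Polynomial.C_neg, Polynomial.natDegree_C]
      by_contra hlt
      exact hab (by rw [hM a b (by omega)]; simp)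

/-- Adding `1` to a single entry changes the characteristic polynomial by a cofactor. -/
theorem charpoly_sub_charpoly_add_single {R : Type*} [CommRing R] {n : ℕ}
    (M : Matrix (Fin n) (Fin n) R) (i j : Fin n) :
    M.charpoly - (M + Matrix.single i j 1).charpoly =
      (M.charmatrix.updateRow i (Pi.single j 1)).det := by
  have h : M.charmatrix = (M + Matrix.single i j 1).charmatrix.updateRow i
      ((M + Matrix.single i j 1).charmatrix i + Pi.single j 1) := by
    ext1 a b
    by_cases ha : a = i
    · subst ha
      by_cases hb : b = j
      · subst hb
        simp only [Matrix.charmatrix, Matrix.updateRow_self, Matrix.sub_apply, Pi.add_apply,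
          Matrix.scalar_apply, RingHom.mapMatrix_apply, Matrix.map_apply, Matrix.add_apply,
          Matrix.single_apply_same, Pi.single_eq_same, map_add, map_one]
        ring
      · simp [Matrix.charmatrix, Matrix.updateRow_self, Matrix.single, Ne.symm hb, hb]
    · simp [Matrix.charmatrix, Matrix.updateRow_ne ha, Matrix.single, Ne.symm ha]
  have hrow : M.charmatrix.updateRow i (Pi.single j 1) =
      (M + Matrix.single i j 1).charmatrix.updateRow i (Pi.single j 1) := by
    rw [h, Matrix.updateRow_idem]
  have hdet := congrArg Matrix.det h
  rw [Matrix.det_updateRow_add, Matrix.updateRow_eq_self] at hdet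
  rw [hrow, Matrix.charpoly, Matrix.charpoly, hdet, add_sub_cancel_left]

/-- Evaluating a ULH superpattern adds the values of the variables, at their positions, to the
constant part. -/
theorem IsULHSuperpatternOf.map_eval {F : Type*} [Field F] {n : ℕ}
    {pos : Fin n → Fin n × Fin n} {A : Matrix (Fin n) (Fin n) (MvPolynomial (Fin n) F)}
    (hA : IsULHSuperpatternOf A (HMat F pos)) (v : Fin n → F) :
    A.map (MvPolynomial.eval v) =
      constPart A + ∑ k, Matrix.single (pos k).1 (pos k).2 (v k) := by
  have hsum (w : Fin n → F) (i j : Fin n) : MvPolynomial.eval w (HMat F pos i j) =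
      (if (j : ℕ) = (i : ℕ) + 1 then 1 else 0) + ∑ k, if pos k = (i, j) then w k else 0 := by
    simp only [HMat, map_add, map_sum, apply_ite (MvPolynomial.eval w), MvPolynomial.eval_X,
      map_one, map_zero]
  ext i j
  have hsingle : (∑ k, Matrix.single (pos k).1 (pos k).2 (v k)) i j =
      ∑ k, if pos k = (i, j) then v k else 0 := by
    simp [Matrix.sum_apply, Matrix.single_apply, Prod.ext_iff]
  rw [Matrix.add_apply, hsingle, Matrix.map_apply, constPart, Matrix.map_apply]
  have hpat (h : A i j = HMat F pos i j) : MvPolynomial.eval v (A i j) =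
      MvPolynomial.eval (fun _ => 0) (A i j) + ∑ k, if pos k = (i, j) then v k else 0 := by
    rw [h, hsum, hsum]
    simp
  rcases lt_or_ge (i : ℕ) (j : ℕ) with hij | hij
  · exact hpat (hA.1 i j hij)
  · rcases hA.2 i j hij with h | ⟨h0, c, -, hc⟩
    · exact hpat h
    · have hzero := hsum v i j
      rw [h0, map_zero, if_neg (by omega), zero_add] at hzero
      rw [hc, MvPolynomial.eval_C, MvPolynomial.eval_C, ← hzero, add_zero]

theorem constPart_eq_zero_of_superpattern {F : Type*} [Field F] {n : ℕ}
    {pos : Fin n → Fin n × Fin n} {A : Matrix (Fin n) (Fin n) (MvPolynomial (Fin n) F)}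
    (hA : IsULHSuperpatternOf A (HMat F pos)) (i j : Fin n) (hij : (i : ℕ) + 1 < (j : ℕ)) :
    constPart A i j = 0 := by
  rw [constPart, Matrix.map_apply, hA.1 i j (by omega), HMat, if_neg (by omega)]
  simp [apply_ite]

/-- In the order `≺` the subdiagonal on which the variables lie is nondecreasing. -/
theorem IsHPos.sub_le_sub {n : ℕ} {pos : Fin n → Fin n × Fin n} (hpos : IsHPos pos)
    {k l : Fin n} (hkl : k ≤ l) :
    ((pos k).1 : ℕ) - ((pos k).2 : ℕ) ≤ ((pos l).1 : ℕ) - ((pos l).2 : ℕ) := by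
  rcases hkl.eq_or_lt with rfl | h
  · exact le_rfl
  · rcases hpos.2 k l h with h | h
    · exact h.le
    · exact h.1.le

/-- A linearly independent family of polynomials of degree less than `d` has at most `d`
members. -/
theorem LinearIndependent.le_of_mem_degreeLT {F : Type*} [Field F] {m d : ℕ}
    {q : Fin m → F[X]} (hq : LinearIndependent F q) (hd : ∀ i, q i ∈ degreeLT F d) : m ≤ d := by
  have : Module.Finite F (degreeLT F d) := Module.Finite.equiv (degreeLTEquiv F d).symm
  have hli : LinearIndependent F fun i => (⟨q i, hd i⟩ : degreeLT F d) :=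
    LinearIndependent.of_comp (degreeLT F d).subtype hq
  simpa [(degreeLTEquiv F d).finrank_eq] using hli.fintype_card_le_finrank

/-- In a PB-companion superpattern the variable `x_k` lies on or above the `k`-subdiagonal. -/
theorem sub_le_of_pbCompanion {F : Type*} [Field F] {n : ℕ}
    {pos : Fin n → Fin n × Fin n} (hpos : IsHPos pos)
    {A : Matrix (Fin n) (Fin n) (MvPolynomial (Fin n) F)}
    (hA : IsULHSuperpatternOf A (HMat F pos)) (hPB : IsPBCompanion A) (k : Fin n) :
    ((pos k).1 : ℕ) - ((pos k).2 : ℕ) ≤ (k : ℕ) := by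
  obtain ⟨-, p, -, hli, -, hchar⟩ := hPB
  have heval (v : Fin n → F) : (constPart A +
      ∑ k, Matrix.single (pos k).1 (pos k).2 (v k)).charpoly =
        p ⟨n, n.lt_succ_self⟩ - ∑ k : Fin n, C (v k) * p ⟨n - 1 - (k : ℕ), by omega⟩ := by
    have hid : (MvPolynomial.eval v).comp (MvPolynomial.C : F →+* MvPolynomial (Fin n) F) =
        RingHom.id F := by
      ext; simp
    have h := congrArg (Polynomial.map (MvPolynomial.eval v)) hchar
    rw [← Matrix.charpoly_map, hA.map_eval] at h
    rw [h]
    simp [Polynomial.map_sub, Polynomial.map_sum, Polynomial.map_map, hid]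
  have hdeg (l : Fin n) : (p ⟨n - 1 - (l : ℕ), by omega⟩).natDegree ≤
      n - 1 - (((pos l).1 : ℕ) - ((pos l).2 : ℕ)) := by
    have h0 := heval 0
    have h1 := heval (Pi.single l 1)
    have hs : ∑ k, Matrix.single (pos k).1 (pos k).2 ((Pi.single l 1 : Fin n → F) k) =
        Matrix.single (pos l).1 (pos l).2 1 := by
      rw [Finset.sum_eq_single l (fun b _ hb => by simp [hb]) (by simp), Pi.single_eq_same]
    have hs' : ∑ k : Fin n, C ((Pi.single l 1 : Fin n → F) k) * p ⟨n - 1 - (k : ℕ), by omega⟩ =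
        p ⟨n - 1 - (l : ℕ), by omega⟩ := by
      rw [Finset.sum_eq_single l (fun b _ hb => by simp [hb]) (by simp), Pi.single_eq_same]
      simp
    rw [hs, hs'] at h1
    simp only [Pi.zero_apply, Matrix.single_zero, Finset.sum_const_zero, add_zero, C_0, zero_mul,
      sub_zero] at h0
    have h := charpoly_sub_charpoly_add_single (constPart A) (pos l).1 (pos l).2
    rw [h1, h0, sub_sub_cancel] at h
    rw [h]
    exact natDegree_det_updateRow_charmatrix_le _ (constPart_eq_zero_of_superpattern hA) _ _
      (hpos.1 l)
  by_contra! hk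
  have hlt : n - (k : ℕ) ≤ n - 1 - (k : ℕ) := by
    refine (hli.comp (Fin.castLE (by omega : n - (k : ℕ) ≤ n + 1))
      (Fin.castLE_injective _)).le_of_mem_degreeLT fun m => ?_
    have hl : n - 1 - (m : ℕ) < n := by omega
    have hm := hdeg ⟨n - 1 - (m : ℕ), hl⟩
    have hmono := hpos.sub_le_sub (show k ≤ ⟨n - 1 - (m : ℕ), hl⟩ from
      Fin.le_def.2 (by simp only; omega))
    have hidx : (⟨n - 1 - (n - 1 - (m : ℕ)), by omega⟩ : Fin (n + 1)) =
        Fin.castLE (by omega : n - (k : ℕ) ≤ n + 1) m :=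
      Fin.ext (by simp only [Fin.val_castLE]; omega)
    simp only [hidx] at hm
    rw [Polynomial.mem_degreeLT]
    exact (Polynomial.natDegree_lt_iff_degree_lt (hli.ne_zero _)).1 (by omega)
  omega

/-- If a ULH superpattern `A` of `B_{(i₁,j₁),…,(iₙ,jₙ)} ∈ ℬ` is
PB-companion, then, writing `pₙ = P_{A₀}` and
`p_{n−k} = P_{A[1,…,jₖ−1]} · P_{A[iₖ+1,…,n]}`, one has `deg p_{n−k} ≥ n − k` for
every `k = 0,1,…,n`. -/
theorem degree_ge_of_pbCompanion {F : Type*} [Field F] {n : ℕ} (hn : 0 < n)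
    (pos : Fin n → Fin n × Fin n) (hpos : IsBPos pos)
    (A : Matrix (Fin n) (Fin n) (MvPolynomial (Fin n) F))
    (hA : IsULHSuperpatternOf A (HMat F pos))
    (hPB : IsPBCompanion A)
    (P : Fin n → Polynomial (MvPolynomial (Fin n) F))
    (hP : ∀ k : Fin n, P k =
      (leadSub A ((pos k).2 : ℕ) ((pos k).2).isLt.le).charpoly *
      (trailSub A (n - 1 - ((pos k).1 : ℕ)) (by omega)).charpoly) :
    n ≤ ((constPart A).charpoly).natDegree ∧
    ∀ k : Fin n, n - 1 - (k : ℕ) ≤ (P k).natDegree := by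
  refine ⟨(Matrix.charpoly_natDegree_eq_dim (constPart A)).trans (Fintype.card_fin n) |>.ge,
    fun k => ?_⟩
  have hk := sub_le_of_pbCompanion hpos.1 hA hPB k
  rw [hP, (Matrix.charpoly_monic _).natDegree_mul (Matrix.charpoly_monic _),
    Matrix.charpoly_natDegree_eq_dim, Matrix.charpoly_natDegree_eq_dim, Fintype.card_fin,
    Fintype.card_fin]
  omega
end
end

section
/- Every matrix of 𝒞̃ is PB-companion: if A is a ULH superpattern of some matrix C_{i_1,…,i_n} ∈ 𝒞, then det(λI_n − A) = p_n(λ) − x_1 p_{n−1}(λ) − ⋯ − x_n p_0(λ) for some basis {p_n(λ),…,p_0(λ)} of the vector space F_n[λ] of polynomials of degree at most n. -/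
open Polynomial Matrix

noncomputable section

section

variable {F R : Type*} [Field F] [CommRing R] {n : ℕ}

/-- The transpose of a ULH matrix along the antidiagonal is ULH. -/
theorem IsULH.antitranspose {A : Matrix (Fin n) (Fin n) R} (hA : IsULH A) :
    IsULH (Aᵀ.submatrix Fin.rev Fin.rev) :=
  ⟨fun i j h => hA.1 _ _ (by simp only [Fin.val_rev]; omega),
    fun i j h => hA.2 _ _ (by simp only [Fin.val_rev]; omega)⟩

/-- If `a 0 = 1` and `a` is annihilated by all rows of `X - A` but the last, then `a j` is a
polynomial of degree `j` over `F` as long as the rows above the `j`-th have constant entries. -/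
theorem IsULH.exists_degree_eq_map_eq (φ : F →+* R) {A : Matrix (Fin n) (Fin n) R}
    (hA : IsULH A) (t : ℕ) (hc : ∀ i j : Fin n, (i : ℕ) < t → ∃ c, A i j = φ c)
    (a : Fin n → R[X]) (h0 : ∀ i : Fin n, (i : ℕ) = 0 → a i = 1)
    (ha : ∀ i : Fin n, (i : ℕ) + 1 < n → ∑ l, C (A i l) * a l = X * a i) (j : Fin n)
    (hj : (j : ℕ) ≤ t) : ∃ q : F[X], q.degree = (j : ℕ) ∧ q.map φ = a j := by
  induction j using WellFoundedLT.induction with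
  | ind j ih =>
    obtain ⟨_ | i, hi⟩ := j
    · exact ⟨1, by simp, by simp [h0]⟩
    · replace hj : i + 1 ≤ t := hj
      have key : ∀ l : Fin n, ∃ q : F[X], (l : ℕ) ≤ i → q.degree = (l : ℕ) ∧ q.map φ = a l := by
        intro l
        by_cases hl : (l : ℕ) ≤ i
        · obtain ⟨q, hq⟩ := ih l (by simp only [Fin.lt_def]; omega) (by omega)
          exact ⟨q, fun _ => hq⟩
        · exact ⟨0, fun h => absurd h hl⟩
      choose q hq using key
      let k : Fin n := ⟨i, by omega⟩
      choose c hc using fun l => hc k l (by simpa [k] using hj)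
      have hk := hq k le_rfl
      refine ⟨X * q k - ∑ l : Fin n with l ≤ k, C (c l) * q l, ?_, ?_⟩
      · have hX : (X * q k).degree = ((i + 1 : ℕ) : WithBot ℕ) := by
          rw [degree_mul, hk.1, degree_X, add_comm]
          rfl
        rw [degree_sub_eq_left_of_degree_lt, hX]
        rw [hX, ← mem_degreeLT]
        refine Submodule.sum_mem _ fun l hl => ?_
        have hl : (l : ℕ) ≤ i := (Finset.mem_filter.1 hl).2
        rw [← smul_eq_C_mul]
        refine Submodule.smul_mem _ _ ?_
        rw [mem_degreeLT, (hq l hl).1]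
        exact_mod_cast Nat.lt_succ_of_le hl
      · have hsum : (∑ l : Fin n with l ≤ k, C (c l) * q l).map φ =
            ∑ l with l ≤ k, C (A k l) * a l := by
          rw [Polynomial.map_sum]
          refine Finset.sum_congr rfl fun l hl => ?_
          rw [Polynomial.map_mul, map_C, ← hc, (hq l (Finset.mem_filter.1 hl).2).2]
        rw [Polynomial.map_sub, Polynomial.map_mul, map_X, hk.2, ← ha k hi, hsum,
          ← Finset.sum_filter_add_sum_filter_not Finset.univ (· ≤ k), add_sub_cancel_left,
          Finset.sum_eq_single ⟨i + 1, hi⟩]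
        · rw [hA.1 k _ rfl, C_1, one_mul]
        · intro l hl hne
          have hl : ¬ (l : ℕ) ≤ i := (Finset.mem_filter.1 hl).2
          rw [hA.2 k l, C_0, zero_mul]
          have : (l : ℕ) ≠ i + 1 := fun h => hne (Fin.ext h)
          change i + 1 < _
          omega
        · simp [k]

/-- The corner entry of the adjugate of the characteristic matrix of a ULH matrix is `1`. -/
theorem IsULH.adjugate_charmatrix_zero_last {A : Matrix (Fin (n + 1)) (Fin (n + 1)) R}
    (hA : IsULH A) : A.charmatrix.adjugate 0 (Fin.last n) = 1 := by
  have hdiag : ∀ i : Fin n, A.charmatrix i.castSucc i.succ = -1 := fun i => by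
    rw [charmatrix_apply_ne _ _ _ (Fin.castSucc_lt_succ).ne, hA.1 _ _ (by simp), C_1]
  rw [adjugate_fin_succ_eq_det_submatrix, det_of_isLowerTriangular]
  · simp [hdiag, ← mul_pow]
  · intro i j hij
    have hij : (i : ℕ) < (j : ℕ) := hij
    have hne : i.castSucc ≠ j.succ := fun h => by
      have := congrArg Fin.val h
      simp at this
      omega
    simp only [submatrix_apply, Fin.succAbove_last, Fin.zero_succAbove]
    rw [charmatrix_apply_ne _ _ _ hne, hA.2 _ _ (by simpa using hij), C_0, neg_zero]

end

/-- Polynomials of degrees `0, …, n - 1` form a basis of the polynomials of degree less than `n`. -/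
theorem linearIndependent_and_span_eq_degreeLT {F : Type*} [Field F] {n : ℕ}
    (p : Fin n → F[X]) (hp : ∀ i, (p i).degree = (i : ℕ)) :
    LinearIndependent F p ∧ Submodule.span F (Set.range p) = degreeLT F n := by
  let S : Polynomial.Sequence F :=
    ⟨fun i => if h : i < n then p ⟨i, h⟩ else X ^ i, fun i => by
      split_ifs with h
      · exact hp ⟨i, h⟩
      · exact degree_X_pow i⟩
  have hS : p = S ∘ Fin.val := by
    ext1 i
    change p i = if h : (i : ℕ) < n then p ⟨i, h⟩ else X ^ (i : ℕ)
    simp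
  constructor
  · rw [hS]
    exact S.linearIndependent.comp _ Fin.val_injective
  · rw [hS, Set.range_comp, Fin.range_val]
    exact S.span_degreeLT fun i _ => by simp

/-- If the variable entries of a ULH matrix all lie in rows `≥ t` and columns `≤ t`, its
characteristic polynomial expands along that block, with polynomial cofactors over `F`. -/
theorem IsULH.exists_charpoly_eq_sum {F R : Type*} [Field F] [CommRing R] (φ : F →+* R) {n : ℕ}
    {A : Matrix (Fin n) (Fin n) R} (hA : IsULH A) (t : Fin n)
    (hrow : ∀ i j : Fin n, i < t → ∃ c, A i j = φ c)
    (hcol : ∀ i j : Fin n, t < j → ∃ c, A i j = φ c) :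
    ∃ α β : Fin n → F[X],
      (∀ j ≤ t, (α j).degree = (j : ℕ)) ∧ (∀ j, t < j → α j = 0) ∧
      (∀ i, t ≤ i → (β i).degree = (n - 1 - (i : ℕ) : ℕ)) ∧ (∀ i < t, β i = 0) ∧
      A.charpoly = ∑ i, ∑ j, (β i).map φ * A.charmatrix i j * (α j).map φ := by
  obtain ⟨m, rfl⟩ : ∃ m, n = m + 1 := ⟨n - 1, by have := t.isLt; omega⟩
  let M := A.charmatrix
  let a : Fin (m + 1) → R[X] := fun j => M.adjugate j (Fin.last m)
  let b : Fin (m + 1) → R[X] := fun i => M.adjugate 0 i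
  have hM : ∀ i j, M i j = (if i = j then X else 0) - C (A i j) := fun i j => by
    simp [M, charmatrix_apply, diagonal_apply]
  have ha : ∀ i, ∑ l, M i l * a l = if i = Fin.last m then M.det else 0 := fun i => by
    have := congrFun (congrFun (mul_adjugate M) i) (Fin.last m)
    simpa [mul_apply, one_apply] using this
  have hb : ∀ j, ∑ l, b l * M l j = if j = 0 then M.det else 0 := fun j => by
    have := congrFun (congrFun (adjugate_mul M) 0) j
    simpa [mul_apply, one_apply, eq_comm] using this
  have hcorner : M.adjugate 0 (Fin.last m) = 1 := hA.adjugate_charmatrix_zero_last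
  have hα : ∀ j : Fin (m + 1), ∃ q : F[X], (j ≤ t → q.degree = (j : ℕ) ∧ q.map φ = a j) ∧
      (t < j → q = 0) := by
    intro j
    rcases le_or_gt j t with hj | hj
    · obtain ⟨q, hq⟩ := hA.exists_degree_eq_map_eq φ t hrow a
        (fun i hi => by rw [show i = 0 from Fin.ext hi]; exact hcorner)
        (fun i hi => by
          have := ha i
          rw [if_neg (by rintro rfl; simp at hi)] at this
          simp only [hM, sub_mul, ite_mul, zero_mul, Finset.sum_sub_distrib, Finset.sum_ite_eq,
            Finset.mem_univ, if_true] at this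
          exact (sub_eq_zero.1 this).symm) j hj
      exact ⟨q, fun _ => hq, fun h => absurd hj h.not_ge⟩
    · exact ⟨0, fun h => absurd h hj.not_ge, fun _ => rfl⟩
  have hβ : ∀ i : Fin (m + 1), ∃ q : F[X],
      (t ≤ i → q.degree = (m - (i : ℕ) : ℕ) ∧ q.map φ = b i) ∧ (i < t → q = 0) := by
    intro i
    rcases le_or_gt t i with hi | hi
    · obtain ⟨q, hq⟩ := hA.antitranspose.exists_degree_eq_map_eq φ t.rev
        (fun i j h => hcol _ _ (by
          simp only [Fin.val_rev] at h
          simp only [Fin.lt_def, Fin.val_rev]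
          omega))
        (fun i => b i.rev)
        (fun i hi => by rw [show i = 0 from Fin.ext hi, Fin.rev_zero]; exact hcorner)
        (fun i hi => by
          have := hb i.rev
          rw [if_neg (by
            intro h
            have := congrArg Fin.val h
            simp only [Fin.val_rev, Fin.val_zero] at this
            omega)] at this
          simp only [hM, mul_sub, mul_ite, mul_zero, Finset.sum_sub_distrib, Finset.sum_ite_eq',
            Finset.mem_univ, if_true] at this
          rw [mul_comm, sub_eq_zero.1 this, ← Equiv.sum_comp Fin.revPerm]
          simp [mul_comm]) i.rev
        (by
          have : t.val ≤ i.val := hi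
          simp only [Fin.val_rev]
          omega)
      refine ⟨q, fun _ => ⟨?_, by simpa using hq.2⟩, fun h => absurd hi h.not_ge⟩
      rw [hq.1, Fin.val_rev]
      congr 1
      omega
    · exact ⟨0, fun h => absurd h hi.not_ge, fun _ => rfl⟩
  choose α hα hα0 using hα
  choose β hβ hβ0 using hβ
  refine ⟨α, β, fun j hj => (hα j hj).1, hα0, fun i hi => (hβ i hi).1, hβ0, ?_⟩
  have hzero : ∀ i < t, ∑ j, M i j * (α j).map φ = 0 := by
    intro i hi
    have hlast : i ≠ Fin.last m := (hi.trans_le t.le_last).ne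
    rw [← (ha i).trans (if_neg hlast)]
    refine Finset.sum_congr rfl fun j _ => ?_
    rcases le_or_gt j t with hj | hj
    · rw [(hα j hj).2]
    · have hij : (i : ℕ) + 1 < j := by
        simp only [Fin.lt_def] at hi hj
        omega
      rw [hM, hA.2 i j hij, if_neg (hi.trans hj).ne]
      simp
  calc A.charpoly = ∑ j, (∑ i, b i * M i j) * (α j).map φ := by
        simp only [hb, ite_mul, zero_mul, Finset.sum_ite_eq', Finset.mem_univ, if_true]
        rw [(hα 0 (Fin.zero_le _)).2, show a 0 = 1 from hcorner, mul_one]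
        rfl
    _ = ∑ i, b i * ∑ j, M i j * (α j).map φ := by
        simp only [Finset.sum_mul, Finset.mul_sum, mul_assoc]
        exact Finset.sum_comm
    _ = ∑ i, (β i).map φ * ∑ j, M i j * (α j).map φ := by
        refine Finset.sum_congr rfl fun i _ => ?_
        rcases le_or_gt t i with hi | hi
        · rw [(hβ i hi).2]
        · rw [hzero i hi, mul_zero, mul_zero]
    _ = _ := by simp only [Finset.mul_sum, mul_assoc, M]

/-- A ULH superpattern of `C_{i₁,…,iₙ}` is ULH, and is a constant matrix plus the variables
at their positions. -/
theorem exists_isULH_and_apply_eq {F : Type*} [Field F] {n : ℕ}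
    (r : Fin n → Fin n) (A : Matrix (Fin n) (Fin n) (MvPolynomial (Fin n) F))
    (hA : IsULHSuperpatternOf A (CMat F r)) :
    IsULH A ∧ ∃ c : Fin n → Fin n → F, ∀ i j, A i j = MvPolynomial.C (c i j) +
      ∑ k : Fin n, if CPos r k = (i, j) then MvPolynomial.X k else 0 := by
  have hupper : ∀ i j : Fin n, (i : ℕ) < j → A i j = if (j : ℕ) = i + 1 then 1 else 0 := by
    intro i j hij
    rw [hA.1 i j hij, CMat, HMat, Finset.sum_eq_zero, add_zero]
    intro k _
    rw [if_neg]
    intro h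
    obtain ⟨h1, h2⟩ := Prod.ext_iff.1 h
    have h1 := congrArg Fin.val h1
    have h2 := congrArg Fin.val h2
    simp only [CPos] at h1 h2
    omega
  refine ⟨⟨fun i j h => ?_, fun i j h => ?_⟩, ?_⟩
  · rw [hupper i j (by omega), if_pos h]
  · rw [hupper i j (by omega), if_neg (by omega)]
  · have : ∀ i j, ∃ c : F, A i j = MvPolynomial.C c + CMat F r i j := by
      intro i j
      rcases lt_or_ge (i : ℕ) j with h | h
      · exact ⟨0, by rw [hA.1 i j h, MvPolynomial.C_0, zero_add]⟩
      · rcases hA.2 i j h with h | ⟨h, c, -, hc⟩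
        · exact ⟨0, by rw [h, MvPolynomial.C_0, zero_add]⟩
        · exact ⟨c, by rw [h, hc, add_zero]⟩
    choose c hc using this
    refine ⟨fun i j => c i j + if (j : ℕ) = i + 1 then 1 else 0, fun i j => ?_⟩
    rw [hc, CMat, HMat, ← add_assoc, MvPolynomial.C_add]
    split_ifs <;> simp

/-- Every matrix of `𝒞̃` is PB-companion: if `A` is a ULH
superpattern of some `C_{i₁,…,iₙ} ∈ 𝒞`, then
`det(λI − A) = pₙ(λ) − x₁p_{n−1}(λ) − ⋯ − xₙp₀(λ)` for some basis `{pₙ,…,p₀}` of the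
space `F_n[λ]` of polynomials of degree at most `n`. -/
theorem mem_Ctilde_isPBCompanion {F : Type*} [Field F] {n : ℕ} (hn : 0 < n)
    (r : Fin n → Fin n) (hr : IsCIdx hn r)
    (A : Matrix (Fin n) (Fin n) (MvPolynomial (Fin n) F))
    (hA : IsULHSuperpatternOf A (CMat F r)) :
    ∃ p : Fin (n + 1) → Polynomial F,
      (∀ i, p i ∈ Polynomial.degreeLT F (n + 1)) ∧
      LinearIndependent F p ∧
      Submodule.span F (Set.range p) = Polynomial.degreeLT F (n + 1) ∧
      A.charpoly =
        (p ⟨n, n.lt_succ_self⟩).map (MvPolynomial.C : F →+* MvPolynomial (Fin n) F) -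
        ∑ k : Fin n, Polynomial.C (MvPolynomial.X k) *
          (p ⟨n - 1 - (k : ℕ), by omega⟩).map
            (MvPolynomial.C : F →+* MvPolynomial (Fin n) F) := by
  obtain ⟨hULH, c, hc⟩ := exists_isULH_and_apply_eq r A hA
  set t : Fin n := r ⟨0, hn⟩
  have hconst : ∀ i j : Fin n, (i < t ∨ t < j) → A i j = MvPolynomial.C (c i j) := by
    intro i j hij
    rw [hc, Finset.sum_eq_zero, add_zero]
    intro k _
    rw [if_neg]
    intro h
    obtain ⟨rfl, rfl⟩ := Prod.ext_iff.1 h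
    have := hr k
    simp only [CPos, Fin.lt_def] at hij
    omega
  obtain ⟨α, β, hα, hα0, hβ, hβ0, hchar⟩ :=
    hULH.exists_charpoly_eq_sum (MvPolynomial.C : F →+* MvPolynomial (Fin n) F) t
      (fun i j h => ⟨_, hconst i j (.inl h)⟩) (fun i j h => ⟨_, hconst i j (.inr h)⟩)
  let P : F[X] := X * (β t * α t) - ∑ i, ∑ j, C (c i j) * (β i * α j)
  have hPdeg : P.degree = (n : WithBot ℕ) := by
    have hX : (X * (β t * α t)).degree = (n : WithBot ℕ) := by
      rw [degree_mul, degree_mul, degree_X, hα t le_rfl, hβ t le_rfl]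
      norm_cast
      omega
    rw [degree_sub_eq_left_of_degree_lt, hX]
    rw [hX, ← mem_degreeLT]
    refine Submodule.sum_mem _ fun i _ => Submodule.sum_mem _ fun j _ => ?_
    rw [← smul_eq_C_mul]
    refine Submodule.smul_mem _ _ ?_
    rcases lt_or_ge i t with hi | hi
    · simp [hβ0 i hi]
    rcases lt_or_ge t j with hj | hj
    · simp [hα0 j hj]
    rw [mem_degreeLT, degree_mul, hα j hj, hβ i hi]
    simp only [Fin.le_def] at hi hj
    norm_cast
    omega
  let Q : Fin n → F[X] := fun k => β (CPos r k).1 * α (CPos r k).2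
  have hQdeg : ∀ k : Fin n, (Q k).degree = (n - 1 - (k : ℕ) : ℕ) := by
    intro k
    have h := hr k
    change _ ∧ _ ≤ t.val ∧ t.val ≤ _ at h
    rw [degree_mul, hα _ h.2.1, hβ (CPos r k).1 h.2.2]
    simp only [CPos]
    norm_cast
    omega
  let p : Fin (n + 1) → F[X] := fun i =>
    if h : (i : ℕ) = n then P else Q ⟨n - 1 - i, by omega⟩
  have hp : ∀ i, (p i).degree = (i : ℕ) := by
    intro i
    by_cases h : (i : ℕ) = n
    · simp only [p, dif_pos h, hPdeg, h]
    · simp only [p, dif_neg h, hQdeg]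
      congr 1
      omega
  obtain ⟨hli, hspan⟩ := linearIndependent_and_span_eq_degreeLT p hp
  refine ⟨p, fun i => hspan ▸ Submodule.subset_span ⟨i, rfl⟩, hli, hspan, ?_⟩
  have hpn : p ⟨n, n.lt_succ_self⟩ = P := dif_pos rfl
  have hpk : ∀ k : Fin n, p ⟨n - 1 - (k : ℕ), by omega⟩ = Q k := by
    intro k
    simp only [p]
    rw [dif_neg (by omega)]
    congr 1
    ext
    simp only
    omega
  simp only [hpn, hpk]
  have hentry : ∀ i j : Fin n,
      (β i).map (MvPolynomial.C : F →+* MvPolynomial (Fin n) F) * A.charmatrix i j *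
          (α j).map MvPolynomial.C =
        (if i = j then X * ((β i).map MvPolynomial.C * (α j).map MvPolynomial.C) else 0) -
          C (MvPolynomial.C (c i j)) * ((β i).map MvPolynomial.C * (α j).map MvPolynomial.C) -
          ∑ k : Fin n, if CPos r k = (i, j) then
            C (MvPolynomial.X k) * ((β i).map MvPolynomial.C * (α j).map MvPolynomial.C)
            else 0 := by
    intro i j
    rw [charmatrix_apply, diagonal_apply, hc, C_add, map_sum, ← sub_sub, mul_sub, sub_mul,
      Finset.mul_sum, Finset.sum_mul]
    congr 1
    · split_ifs <;> ring
    · refine Finset.sum_congr rfl fun k _ => ?_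
      split_ifs
      · ring
      · simp
  have hdiag : ∀ i : Fin n, β i * α i = if i = t then β t * α t else 0 := by
    intro i
    rcases lt_trichotomy i t with h | rfl | h
    · rw [hβ0 i h, zero_mul, if_neg h.ne]
    · rw [if_pos rfl]
    · rw [hα0 i h, mul_zero, if_neg h.ne']
  have hvar : ∀ i j k : Fin n, (if CPos r k = (i, j) then
      C (MvPolynomial.X k) * ((β i).map (MvPolynomial.C : F →+* MvPolynomial (Fin n) F) *
        (α j).map MvPolynomial.C) else 0) =
      if (CPos r k).1 = i then if (CPos r k).2 = j then
        C (MvPolynomial.X k) * (Q k).map MvPolynomial.C else 0 else 0 := by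
    intro i j k
    by_cases h1 : (CPos r k).1 = i
    · by_cases h2 : (CPos r k).2 = j
      · rw [if_pos (Prod.ext h1 h2), if_pos h1, if_pos h2, ← h1, ← h2, Polynomial.map_mul]
      · rw [if_neg (fun h => h2 (congrArg Prod.snd h)), if_pos h1, if_neg h2]
    · rw [if_neg (fun h => h1 (congrArg Prod.fst h)), if_neg h1]
  rw [hchar]
  simp only [hentry, Finset.sum_sub_distrib, hvar]
  congr 1
  · simp only [Finset.sum_ite_eq, Finset.mem_univ, if_true, P, Polynomial.map_sub,
      Polynomial.map_sum, Polynomial.map_mul, map_X, map_C]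
    congr 1
    rw [← Finset.mul_sum]
    congr 1
    simp only [← Polynomial.map_mul, ← Polynomial.map_sum]
    rw [Finset.sum_congr rfl fun i _ => hdiag i, Finset.sum_ite_eq', if_pos (Finset.mem_univ t)]
  · rw [Finset.sum_congr rfl fun i _ => Finset.sum_comm, Finset.sum_comm]
    simp only [Finset.sum_ite_irrel, Finset.sum_const_zero, Finset.sum_ite_eq, Finset.mem_univ,
      if_true]
end
end
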